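/- Let m ≥ 2 and let W be G(m,1,n) or G(m,m,n), and let g ∈ W be a parabolic quasi-Coxeter element as described in each case below; in each case relative generating sets for g consist of exactly k reflections. (i) If either W = G(m,1,n) and the underlying permutation of g has one cycle of length λ_0 whose color generates ℤ/mℤ and k further cycles of lengths λ_1, …, λ_k each of color 0 (so g is quasi-Coxeter for a parabolic subgroup of type G(m,1,λ_0) × S_{λ_1} × ⋯ × S_{λ_k}), or W = G(m,m,n) and g has two cycles whose colors generate ℤ/mℤ and sum to 0 with lengths summing to λ_0, together with k cycles of color 0 of lengths λ_1, …, λ_k (so g is quasi-Coxeter for a parabolic of type G(m,m,λ_0) × S_{λ_1} × ⋯ × S_{λ_k}), then #RGS(W, g) = m^k · n^{k−1} · λ_0 λ_1 ⋯ λ_k. (ii) If W = G(m,1,n) and every cycle of g has color 0, with cycle lengths λ_1, …, λ_k, then #RGS(W, g) = φ(m) · m^{k−1} · n^{k−1} · λ_1 ⋯ λ_k, where φ is Euler's totient function. (iii) If W = G(m,m,n) and every cycle of g has color 0, with cycle lengths λ_1, …, λ_k, then #RGS(W, g) = (φ(m) · m^{k−1} / 2) · ( n^k − n^{k−1} − Σ_{j=2}^{k}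 (j−2)! · n^{k−j} · e_j(λ) ) · λ_1 ⋯ λ_k, where e_j(λ) is the j-th elementary symmetric polynomial in λ_1, …, λ_k. -/

import Mathlib

open scoped Classical

namespace Comb

variable {G : Type*} [Group G]

/-- Reflection length of `g` with respect to a set `R` of "reflections". -/
noncomputable def rLen (R : Set G) (g : G) : ℕ :=
  sInf {k | ∃ l : List G, (∀ x ∈ l, x ∈ R) ∧ l.prod = g ∧ l.length = k}

/-- Reduced reflection factorizations of `g` with respect to `R`. -/
def Red (R : Set G) (g : G) : Set (List G) :=
  {l | (∀ x ∈ l, x ∈ R) ∧ l.prod = g ∧ l.length = rLen R g}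

/-- Relative generating sets of `g` with respect to the reflections `R` of a group
`H` of rank `rk`: sets of `rk - ℓ_R(g)` reflections which together with the factors
of some reduced reflection factorization of `g` generate `H`. -/
def RGS (R : Set G) (H : Subgroup G) (rk : ℕ) (g : G) : Set (Finset G) :=
  {S | ↑S ⊆ R ∧ S.card = rk - rLen R g ∧
    ∃ l ∈ Red R g, Subgroup.closure (↑S ∪ {x | x ∈ l}) = H}

end Comb

/-- The wreath product `G(m,1,n) = (ℤ/mℤ) ≀ S_n`: pairs `[u; a]` of a permutation
`u` of `{1,…,n}` and a tuple of colors `a : Fin n → ℤ/mℤ`. -/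
@[ext] structure GW (m n : ℕ) where
  perm : Equiv.Perm (Fin n)
  col : Fin n → ZMod m

namespace GW

variable {m n : ℕ}

instance : Mul (GW m n) :=
  ⟨fun x y => ⟨x.perm * y.perm, fun k => x.col (y.perm k) + y.col k⟩⟩
instance : One (GW m n) := ⟨⟨1, 0⟩⟩
instance : Inv (GW m n) :=
  ⟨fun x => ⟨x.perm⁻¹, fun k => -(x.col (x.perm⁻¹ k))⟩⟩

@[simp] lemma mul_perm (x y : GW m n) : (x * y).perm = x.perm * y.perm := rfl
@[simp] lemma mul_col (x y : GW m n) (k : Fin n) :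
    (x * y).col k = x.col (y.perm k) + y.col k := rfl
@[simp] lemma one_perm : (1 : GW m n).perm = 1 := rfl
@[simp] lemma one_col (k : Fin n) : (1 : GW m n).col k = 0 := rfl
@[simp] lemma inv_perm (x : GW m n) : (x⁻¹).perm = x.perm⁻¹ := rfl
@[simp] lemma inv_col (x : GW m n) (k : Fin n) :
    (x⁻¹).col k = -(x.col (x.perm⁻¹ k)) := rfl

instance : Group (GW m n) where
  mul_assoc x y z := by
    ext k
    · simp [mul_assoc]
    · simp [add_assoc]
  one_mul x := by ext k <;> simp
  mul_one x := by ext k <;> simp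
  inv_mul_cancel x := by
    ext k
    · simp
    · simp

/-- The transposition-like reflection `[(i j); c(e_i - e_j)]`. -/
def transRefl (i j : Fin n) (c : ZMod m) : GW m n :=
  ⟨Equiv.swap i j, fun l => if l = i then c else if l = j then -c else 0⟩

/-- The diagonal reflection `[id; c e_i]`. -/
def diagRefl (i : Fin n) (c : ZMod m) : GW m n :=
  ⟨1, fun l => if l = i then c else 0⟩

/-- The reflections of `G(m,1,n)`. -/
def reflG1 : Set (GW m n) :=
  {t | (∃ i j c, i ≠ j ∧ t = transRefl i j c) ∨ ∃ i c, c ≠ 0 ∧ t = diagRefl i c}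

/-- The reflections of `G(m,m,n)`: the transposition-like reflections. -/
def reflGmm : Set (GW m n) :=
  {t | ∃ i j c, i ≠ j ∧ t = transRefl i j c}

/-- The subgroup `G(m,m,n)` of `G(m,1,n)`: elements of total color `0`. -/
def Gmm (m n : ℕ) : Subgroup (GW m n) where
  carrier := {x | ∑ k, x.col k = 0}
  one_mem' := by simp
  mul_mem' := by
    intro a b ha hb
    simp only [Set.mem_setOf_eq] at ha hb ⊢
    simp only [mul_col, Finset.sum_add_distrib]
    rw [Equiv.sum_comp b.perm a.col, ha, hb, add_zero]
  inv_mem' := by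
    intro x hx
    simp only [Set.mem_setOf_eq] at hx ⊢
    simp only [inv_col, Finset.sum_neg_distrib]
    rw [Equiv.sum_comp x.perm⁻¹ x.col, hx, neg_zero]

/-- The cycle (orbit) of `x` under the permutation `u`, fixed points included. -/
noncomputable def orbit (u : Equiv.Perm (Fin n)) (x : Fin n) : Finset (Fin n) :=
  Finset.univ.filter fun y => u.SameCycle x y

/-- The color of the cycle of `g` containing `x`. -/
noncomputable def cycColor (g : GW m n) (x : Fin n) : ZMod m :=
  ∑ y ∈ orbit g.perm x, g.col y

end GW

open scoped Classical

namespace RGSCount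

section Numeric

variable {ι : Type*}

/-- Elementary symmetric function of the weights `w` on the finset `B`. -/
noncomputable def es (B : Finset ι) (w : ι → ℚ) (j : ℕ) : ℚ :=
  ∑ T ∈ B.powersetCard j, ∏ i ∈ T, w i

lemma es_zero (B : Finset ι) (w : ι → ℚ) : es B w 0 = 1 := by
  simp [es]

lemma es_one (B : Finset ι) (w : ι → ℚ) : es B w 1 = ∑ a ∈ B, w a := by
  simp [es, Finset.powersetCard_one]

lemma es_insert {B : Finset ι} {x : ι} (hx : x ∉ B) (w : ι → ℚ) (j : ℕ) :
    es (insert x B) w (j + 1) = es B w (j + 1) + w x * es B w j := by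
  unfold es
  rw [Finset.powersetCard_succ_insert hx, Finset.sum_union, Finset.sum_image, Finset.mul_sum]
  · congr 1
    apply Finset.sum_congr rfl
    intro T hT
    rw [Finset.mem_powersetCard] at hT
    rw [Finset.prod_insert (fun h => hx (hT.1 h))]
  · intro S hS T hT h
    simp only [Finset.mem_coe, Finset.mem_powersetCard] at hS hT
    have h1 : x ∉ S := fun h => hx (hS.1 h)
    have h2 : x ∉ T := fun h => hx (hT.1 h)
    rw [← Finset.erase_insert h1, ← Finset.erase_insert h2, h]
  · rw [Finset.disjoint_left]
    intro S hS hS'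
    simp only [Finset.mem_image, Finset.mem_powersetCard] at hS hS'
    obtain ⟨T, hT, rfl⟩ := hS'
    exact hx (hS.1 (Finset.mem_insert_self _ _))

lemma es_erase {B : Finset ι} {x : ι} (hx : x ∈ B) (w : ι → ℚ) (j : ℕ) :
    es B w (j + 1) = es (B.erase x) w (j + 1) + w x * es (B.erase x) w j := by
  conv_lhs => rw [← Finset.insert_erase hx]
  exact es_insert (Finset.notMem_erase _ _) w j

lemma es_congr {B : Finset ι} {w w' : ι → ℚ} (h : ∀ a ∈ B, w a = w' a) (j : ℕ) :
    es B w j = es B w' j := by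
  unfold es
  refine Finset.sum_congr rfl fun T hT => Finset.prod_congr rfl fun i hi => h i ?_
  exact (Finset.mem_powersetCard.1 hT).1 hi

lemma sum_es (B : Finset ι) (w : ι → ℚ) (j : ℕ) :
    ∑ a ∈ B, w a * es (B.erase a) w j = (j + 1) * es B w (j + 1) := by
  induction B using Finset.induction_on generalizing j with
  | empty =>
    have : (∅ : Finset ι).powersetCard (j + 1) = ∅ := Finset.powersetCard_eq_empty.2 (by simp)
    simp [es, this]
  | insert x B hx ih =>
    rw [Finset.sum_insert hx, Finset.erase_insert hx, es_insert hx]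
    cases j with
    | zero => simp [es_zero, es_one]; ring
    | succ j =>
      have : ∑ a ∈ B, w a * es ((insert x B).erase a) w (j + 1)
          = ∑ a ∈ B, (w a * es (B.erase a) w (j + 1) + w x * (w a * es (B.erase a) w j)) := by
        refine Finset.sum_congr rfl fun a ha => ?_
        have hxa : x ≠ a := fun h => hx (h ▸ ha)
        rw [Finset.erase_insert_of_ne hxa, es_insert (fun h => hx (Finset.mem_of_mem_erase h))]
        ring
      rw [this, Finset.sum_add_distrib, ← Finset.mul_sum, ih, ih]
      push_cast
      ring

/-- Weights after merging label `c` into label `a`. -/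
noncomputable def mergeW (w : ι → ℚ) (a c : ι) : ι → ℚ := Function.update w a (w a + w c)

lemma es_merge {B : Finset ι} {a c : ι} (ha : a ∈ B) (hc : c ∈ B) (hac : a ≠ c) (w : ι → ℚ)
    (j : ℕ) :
    es (B.erase c) (mergeW w a c) (j + 2)
      = es B w (j + 2) - w a * w c * es ((B.erase a).erase c) w j := by
  have ha' : a ∈ B.erase c := Finset.mem_erase.2 ⟨hac, ha⟩
  have hcong : ∀ i, es ((B.erase c).erase a) (mergeW w a c) i = es ((B.erase a).erase c) w i := by
    intro i
    rw [Finset.erase_right_comm]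
    apply es_congr
    intro z hz
    simp only [Finset.mem_erase] at hz
    simp [mergeW, hz.2.1]
  have hc' : c ∈ B.erase a := Finset.mem_erase.2 ⟨hac.symm, hc⟩
  rw [es_erase ha', hcong, hcong, es_erase ha, es_erase hc', es_erase hc' w j]
  simp only [mergeW, Function.update_self]
  ring

lemma sum_mergeW {B : Finset ι} {a c : ι} (ha : a ∈ B) (hc : c ∈ B) (hac : a ≠ c) (w : ι → ℚ) :
    ∑ z ∈ B.erase c, mergeW w a c z = ∑ z ∈ B, w z := by
  have ha' : a ∈ B.erase c := Finset.mem_erase.2 ⟨hac, ha⟩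
  rw [← Finset.add_sum_erase _ _ ha', ← Finset.add_sum_erase B _ hc,
    ← Finset.add_sum_erase _ w ha']
  have : ∑ z ∈ (B.erase c).erase a, mergeW w a c z = ∑ z ∈ (B.erase c).erase a, w z := by
    refine Finset.sum_congr rfl fun z hz => ?_
    simp [mergeW, (Finset.mem_erase.1 hz).1]
  rw [this]
  simp only [mergeW, Function.update_self]
  ring

lemma prod_mergeW {B : Finset ι} {a c : ι} (ha : a ∈ B) (hc : c ∈ B) (hac : a ≠ c) (w : ι → ℚ) :
    w a * w c * ∏ z ∈ B.erase c, mergeW w a c z = (w a + w c) * ∏ z ∈ B, w z := by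
  have ha' : a ∈ B.erase c := Finset.mem_erase.2 ⟨hac, ha⟩
  rw [← Finset.mul_prod_erase _ _ ha', ← Finset.mul_prod_erase B _ hc,
    ← Finset.mul_prod_erase _ w ha']
  have : ∏ z ∈ (B.erase c).erase a, mergeW w a c z = ∏ z ∈ (B.erase c).erase a, w z := by
    refine Finset.prod_congr rfl fun z hz => ?_
    simp [mergeW, (Finset.mem_erase.1 hz).1]
  rw [this]
  simp only [mergeW, Function.update_self]
  ring

lemma sum_pair_symm (B : Finset ι) (F : ι → ι → ℚ) :
    ∑ a ∈ B, ∑ c ∈ B.erase a, F a c = ∑ a ∈ B, ∑ c ∈ B.erase a, F c a := by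
  apply Finset.sum_comm'
  intro x y
  simp only [Finset.mem_erase]
  tauto

lemma sum_pair_add (B : Finset ι) (w : ι → ℚ) :
    ∑ a ∈ B, ∑ c ∈ B.erase a, (w a + w c) = 2 * ((B.card : ℚ) - 1) * ∑ a ∈ B, w a := by
  have h1 : ∑ a ∈ B, ∑ c ∈ B.erase a, (w a + w c)
      = 2 * ∑ a ∈ B, ∑ c ∈ B.erase a, w a := by
    simp only [Finset.sum_add_distrib]
    rw [sum_pair_symm B (fun a c => w c)]
    ring
  rw [h1, mul_assoc, Finset.mul_sum B w]
  congr 1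
  refine Finset.sum_congr rfl fun a ha => ?_
  rw [Finset.sum_const, Finset.card_erase_of_mem ha, nsmul_eq_mul,
    Nat.cast_sub (Finset.card_pos.2 ⟨a, ha⟩)]
  simp

lemma sum_pair_es_merge (B : Finset ι) (w : ι → ℚ) (j : ℕ) :
    ∑ a ∈ B, ∑ c ∈ B.erase a, (w a + w c) * es (B.erase c) (mergeW w a c) (j + 2)
      = 2 * (((B.card : ℚ) - (j + 2)) * (∑ a ∈ B, w a) * es B w (j + 2)
        + (j + 1) * (j + 3) * es B w (j + 3)) := by
  have h1 : ∑ a ∈ B, ∑ c ∈ B.erase a, (w a + w c) * es (B.erase c) (mergeW w a c) (j + 2)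
      = ∑ a ∈ B, ∑ c ∈ B.erase a, (w a + w c) * es B w (j + 2)
        - ∑ a ∈ B, ∑ c ∈ B.erase a,
          (w a * (w a * (w c * es ((B.erase a).erase c) w j))
            + w c * (w a * (w c * es ((B.erase a).erase c) w j))) := by
    rw [← Finset.sum_sub_distrib]
    refine Finset.sum_congr rfl fun a ha => ?_
    rw [← Finset.sum_sub_distrib]
    refine Finset.sum_congr rfl fun c hc => ?_
    rw [Finset.mem_erase] at hc
    rw [es_merge ha hc.2 hc.1.symm]
    ring
  have h2 : ∑ a ∈ B, ∑ c ∈ B.erase a, w c * (w a * (w c * es ((B.erase a).erase c) w j))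
      = ∑ a ∈ B, ∑ c ∈ B.erase a, w a * (w a * (w c * es ((B.erase a).erase c) w j)) := by
    rw [sum_pair_symm]
    refine Finset.sum_congr rfl fun a _ => Finset.sum_congr rfl fun c _ => ?_
    rw [Finset.erase_right_comm]
    ring
  have h3 : ∑ a ∈ B, ∑ c ∈ B.erase a, w a * (w a * (w c * es ((B.erase a).erase c) w j))
      = (j + 1) * ((∑ a ∈ B, w a) * es B w (j + 2) - (j + 3) * es B w (j + 3)) := by
    have : ∀ a ∈ B, ∑ c ∈ B.erase a, w a * (w a * (w c * es ((B.erase a).erase c) w j))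
        = (j + 1) * (w a * es B w (j + 2) - w a * es (B.erase a) w (j + 2)) := by
      intro a ha
      rw [← Finset.mul_sum, ← Finset.mul_sum, sum_es, es_erase ha w (j + 1)]
      ring
    rw [Finset.sum_congr rfl this, ← Finset.mul_sum, Finset.sum_sub_distrib, sum_es,
      Finset.sum_mul]
    push_cast
    ring
  rw [h1]
  simp only [Finset.sum_add_distrib]
  rw [h2, h3, show ∑ a ∈ B, ∑ c ∈ B.erase a, (w a + w c) * es B w (j + 2)
    = (∑ a ∈ B, ∑ c ∈ B.erase a, (w a + w c)) * es B w (j + 2) by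
      simp only [Finset.sum_mul], sum_pair_add]
  ring

/-- The bracket in part (iii). -/
noncomputable def Vf (B : Finset ι) (w : ι → ℚ) (q : ℕ) (N : ℚ) : ℚ :=
  N ^ q - N ^ (q - 1) - ∑ j ∈ Finset.range (q - 1), (j.factorial : ℚ) * N ^ (q - 2 - j)
    * es B w (j + 2)

lemma sum_sq (B : Finset ι) (w : ι → ℚ) :
    ∑ a ∈ B, w a ^ 2 = (∑ a ∈ B, w a) ^ 2 - 2 * es B w 2 := by
  have h := sum_es B w 1
  have h2 : ∑ a ∈ B, w a * es (B.erase a) w 1 = ∑ a ∈ B, (w a * (∑ c ∈ B, w c) - w a ^ 2) := by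
    refine Finset.sum_congr rfl fun a ha => ?_
    rw [es_one, ← Finset.add_sum_erase B w ha]
    ring
  rw [h2, Finset.sum_sub_distrib, ← Finset.sum_mul] at h
  norm_num at h
  linarith

lemma Vf_rec (B : Finset ι) (w : ι → ℚ) (r : ℕ) (hB : B.card = r + 2) (N : ℚ)
    (hN : ∑ a ∈ B, w a = N) :
    2 * (r + 2) * Vf B w (r + 2) N =
      ∑ a ∈ B, ∑ c ∈ B.erase a, (w a + w c) * Vf (B.erase c) (mergeW w a c) (r + 1) N
        + 2 * N ^ r * ∑ a ∈ B, (w a ^ 2 - w a) := by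
  have h1 : ∑ a ∈ B, ∑ c ∈ B.erase a, (w a + w c) * Vf (B.erase c) (mergeW w a c) (r + 1) N
      = (∑ a ∈ B, ∑ c ∈ B.erase a, (w a + w c)) * (N ^ (r + 1) - N ^ r)
        - ∑ j ∈ Finset.range r, (j.factorial : ℚ) * N ^ (r - 1 - j) *
          ∑ a ∈ B, ∑ c ∈ B.erase a, (w a + w c) * es (B.erase c) (mergeW w a c) (j + 2) := by
    simp only [Finset.mul_sum, Finset.sum_mul]
    rw [Finset.sum_comm, ← Finset.sum_sub_distrib]
    refine Finset.sum_congr rfl fun a _ => ?_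
    rw [Finset.sum_comm, ← Finset.sum_sub_distrib]
    refine Finset.sum_congr rfl fun c _ => ?_
    unfold Vf
    simp only [Nat.add_sub_cancel, show r + 1 - 2 = r - 1 by omega]
    rw [mul_sub, Finset.mul_sum]
    congr 1
    refine Finset.sum_congr rfl fun j _ => ?_
    ring
  rw [h1, Finset.sum_sub_distrib, sum_sq, hN]
  simp only [sum_pair_es_merge, sum_pair_add, hB, hN]
  have h2 : ∑ j ∈ Finset.range r, (j.factorial : ℚ) * N ^ (r - 1 - j) *
      (2 * ((((r + 2 : ℕ) : ℚ) - (j + 2)) * N * es B w (j + 2)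
        + (j + 1) * (j + 3) * es B w (j + 3)))
      = 2 * (∑ j ∈ Finset.range r, (j.factorial : ℚ) * (r - j) * N ^ (r - j) * es B w (j + 2))
        + 2 * ∑ j ∈ Finset.range r, ((j + 1).factorial : ℚ) * (j + 1 + 2) * N ^ (r - (j + 1))
          * es B w (j + 1 + 2) := by
    rw [Finset.mul_sum, Finset.mul_sum, ← Finset.sum_add_distrib]
    refine Finset.sum_congr rfl fun j hj => ?_
    have hj := Finset.mem_range.1 hj
    rw [show r - j = (r - 1 - j) + 1 by omega, show r - (j + 1) = r - 1 - j by omega,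
      Nat.factorial_succ, show j + 1 + 2 = j + 3 by omega]
    push_cast
    ring
  have h3 : ∑ j ∈ Finset.range (r + 1), (j.factorial : ℚ) * (j + 2) * N ^ (r - j) * es B w (j + 2)
      = ∑ j ∈ Finset.range r, ((j + 1).factorial : ℚ) * (j + 1 + 2) * N ^ (r - (j + 1))
          * es B w (j + 1 + 2) + 2 * N ^ r * es B w 2 := by
    rw [Finset.sum_range_succ']
    simp
  have h4 : ∑ j ∈ Finset.range (r + 1), (j.factorial : ℚ) * (r - j) * N ^ (r - j) * es B w (j + 2)
      = ∑ j ∈ Finset.range r, (j.factorial : ℚ) * (r - j) * N ^ (r - j) * es B w (j + 2) := by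
    rw [Finset.sum_range_succ]
    simp
  have h5 : ((r : ℚ) + 2) * ∑ j ∈ Finset.range (r + 1), (j.factorial : ℚ) * N ^ (r - j)
        * es B w (j + 2)
      = ∑ j ∈ Finset.range (r + 1), (j.factorial : ℚ) * (r - j) * N ^ (r - j) * es B w (j + 2)
      + ∑ j ∈ Finset.range (r + 1), (j.factorial : ℚ) * (j + 2) * N ^ (r - j) * es B w (j + 2)
      := by
    rw [Finset.mul_sum, ← Finset.sum_add_distrib]
    refine Finset.sum_congr rfl fun j _ => ?_
    ring
  rw [h2]
  unfold Vf
  simp only [show r + 2 - 1 = r + 1 by omega, show r + 2 - 2 = r by omega]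
  rw [h3, h4] at h5
  push_cast
  linear_combination (-2) * h5

end Numeric

end RGSCount

open scoped Classical

namespace RGSCount

open GW

section Lists

variable {X : Type*}

/-- Number of lists of length `q` over `A` satisfying `P`. -/
noncomputable def cnt (A : Finset X) : ℕ → (List X → Prop) → ℚ
  | 0, P => if P [] then 1 else 0
  | q + 1, P => ∑ t ∈ A, cnt A q (fun L => P (t :: L))

lemma cnt_congr (A : Finset X) (q : ℕ) (P Q : List X → Prop)
    (h : ∀ L : List X, L.length = q → (∀ t ∈ L, t ∈ A) → (P L ↔ Q L)) :
    cnt A q P = cnt A q Q := by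
  induction q generalizing P Q with
  | zero =>
    have := h [] rfl (by simp)
    simp [cnt, this]
  | succ q ih =>
    simp only [cnt]
    refine Finset.sum_congr rfl fun t ht => ih _ _ fun L hL hA => h _ (by simp [hL]) ?_
    intro s hs
    rcases List.mem_cons.1 hs with rfl | hs
    · exact ht
    · exact hA s hs

lemma cnt_false (A : Finset X) (q : ℕ) (P : List X → Prop)
    (h : ∀ L : List X, L.length = q → (∀ t ∈ L, t ∈ A) → ¬ P L) :
    cnt A q P = 0 := by
  rw [cnt_congr A q P (fun _ => False) (fun L h1 h2 => iff_of_false (h L h1 h2) id)]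
  clear h
  induction q with
  | zero => simp [cnt]
  | succ q ih => simp [cnt, ih]

lemma cnt_set (A : Finset X) (q : ℕ) (F : Finset (Finset X))
    (h : ∀ S ∈ F, S ⊆ A ∧ S.card = q) :
    cnt A q (fun L => L.toFinset ∈ F) = (q.factorial : ℚ) * F.card := by
  induction q generalizing F with
  | zero =>
    simp only [cnt, List.toFinset_nil, Nat.factorial_zero, Nat.cast_one, one_mul]
    by_cases h0 : ∅ ∈ F
    · have : F = {∅} := by
        ext S
        rw [Finset.mem_singleton]
        refine ⟨fun hS => Finset.card_eq_zero.1 (h S hS).2, fun hS => hS ▸ h0⟩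
      simp [this]
    · have : F = ∅ := by
        ext S
        simp only [Finset.notMem_empty, iff_false]
        intro hS
        exact h0 ((Finset.card_eq_zero.1 (h S hS).2) ▸ hS)
      simp [this]
  | succ q ih =>
    simp only [cnt]
    have key : ∀ t ∈ A, cnt A q (fun L => (t :: L).toFinset ∈ F)
        = (q.factorial : ℚ) * ((F.filter (fun S => t ∈ S)).card : ℚ) := by
      intro t ht
      have h1 : (F.filter (fun S => t ∈ S)).card
          = ((F.filter (fun S => t ∈ S)).image (fun S => S.erase t)).card := by
        rw [Finset.card_image_of_injOn]
        intro S hS T hT hST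
        simp only [Finset.mem_coe, Finset.mem_filter] at hS hT
        rw [← Finset.insert_erase hS.2, ← Finset.insert_erase hT.2]
        exact congrArg _ hST
      rw [h1, ← ih]
      · apply cnt_congr
        intro L hL hA
        simp only [List.toFinset_cons, Finset.mem_image, Finset.mem_filter]
        constructor
        · intro hF
          refine ⟨_, ⟨hF, Finset.mem_insert_self _ _⟩, Finset.erase_insert ?_⟩
          intro hmem
          have := (h _ hF).2
          rw [Finset.insert_eq_of_mem hmem] at this
          have := List.toFinset_card_le L
          omega
        · rintro ⟨S, ⟨hS, htS⟩, hSL⟩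
          rw [← hSL, Finset.insert_erase htS]
          exact hS
      · intro S hS
        simp only [Finset.mem_image, Finset.mem_filter] at hS
        obtain ⟨S', ⟨hS', ht'⟩, rfl⟩ := hS
        refine ⟨(Finset.erase_subset _ _).trans (h _ hS').1, ?_⟩
        rw [Finset.card_erase_of_mem ht', (h _ hS').2]
        rfl
    rw [Finset.sum_congr rfl key, ← Finset.mul_sum]
    have h2 : ∑ t ∈ A, ((F.filter (fun S => t ∈ S)).card : ℚ) = (q + 1) * F.card := by
      have : ∀ t ∈ A, ((F.filter (fun S => t ∈ S)).card : ℚ) = ∑ S ∈ F, if t ∈ S then 1 else 0 := by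
        intro t _
        simp
      rw [Finset.sum_congr rfl this, Finset.sum_comm]
      have : ∀ S ∈ F, ∑ t ∈ A, (if t ∈ S then (1 : ℚ) else 0) = q + 1 := by
        intro S hS
        rw [Finset.sum_ite_mem, Finset.inter_eq_right.2 (h S hS).1]
        simp [(h S hS).2]
      rw [Finset.sum_congr rfl this]
      simp
      ring
    rw [h2, Nat.factorial_succ]
    push_cast
    ring

end Lists

variable {m n : ℕ} {ι : Type*}

lemma transRefl_symm (i j : Fin n) (c : ZMod m) (hij : i ≠ j) :
    transRefl i j c = transRefl j i (-c) := by
  ext k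
  · simp [transRefl, Equiv.swap_comm]
  · simp only [transRefl, neg_neg]
    split_ifs with h1 h2 <;> simp_all

lemma transRefl_inj {i j i' j' : Fin n} {c c' : ZMod m} (hij : i ≠ j)
    (h : transRefl i j c = transRefl i' j' c') :
    (i = i' ∧ j = j' ∧ c = c') ∨ (i = j' ∧ j = i' ∧ c = -c') := by
  have hp : Equiv.swap i j = Equiv.swap i' j' := congrArg GW.perm h
  have hc : ∀ k, (transRefl i j c).col k = (transRefl i' j' c').col k := fun k => by rw [h]
  have hi := congrArg (fun p => p i) hp
  have hj := congrArg (fun p => p j) hp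
  have hci := hc i
  simp only [transRefl, if_true, Equiv.swap_apply_left, Equiv.swap_apply_right] at hi hj hci
  by_cases h1 : i = i'
  · subst h1
    exact Or.inl ⟨rfl, by simpa using hi, by simpa using hci⟩
  · by_cases h2 : i = j'
    · subst h2
      exact Or.inr ⟨rfl, by simpa using hi, by simpa [h1] using hci⟩
    · rw [Equiv.swap_apply_of_ne_of_ne h1 h2] at hi
      exact absurd hi.symm hij

section

variable [NeZero m]

/-- The finset of transposition-like reflections. -/
noncomputable def transFin (m n : ℕ) [NeZero m] : Finset (GW m n) :=
  ((Finset.univ : Finset (Fin n × Fin n × ZMod m)).filter (fun p => p.1 ≠ p.2.1)).image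
    (fun p => transRefl p.1 p.2.1 p.2.2)

lemma mem_transFin {t : GW m n} : t ∈ transFin m n ↔ ∃ i j c, i ≠ j ∧ t = transRefl i j c := by
  simp only [transFin, Finset.mem_image, Finset.mem_filter, Finset.mem_univ, true_and,
    Prod.exists]
  constructor
  · rintro ⟨i, j, c, h, rfl⟩
    exact ⟨i, j, c, h, rfl⟩
  · rintro ⟨i, j, c, h, rfl⟩
    exact ⟨i, j, c, h, rfl⟩

lemma two_sum_trans (F : GW m n → ℚ) :
    2 * ∑ t ∈ transFin m n, F t
      = ∑ i, ∑ j, ∑ c : ZMod m, if i ≠ j then F (transRefl i j c) else 0 := by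
  have h1 : ∑ i, ∑ j, ∑ c : ZMod m, (if i ≠ j then F (transRefl i j c) else 0)
      = ∑ p ∈ (Finset.univ : Finset (Fin n × Fin n × ZMod m)).filter (fun p => p.1 ≠ p.2.1),
        F (transRefl p.1 p.2.1 p.2.2) := by
    rw [Finset.sum_filter, Fintype.sum_prod_type]
    simp only [Fintype.sum_prod_type]
  rw [h1, Finset.sum_comp F (fun p : Fin n × Fin n × ZMod m => transRefl p.1 p.2.1 p.2.2),
    Finset.mul_sum]
  refine Finset.sum_congr rfl fun t ht => ?_
  obtain ⟨i, j, c, hij, rfl⟩ := mem_transFin.1 ht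
  have : ((Finset.univ : Finset (Fin n × Fin n × ZMod m)).filter (fun p => p.1 ≠ p.2.1)).filter
      (fun p => transRefl p.1 p.2.1 p.2.2 = transRefl i j c) = {(i, j, c), (j, i, -c)} := by
    ext ⟨i', j', c'⟩
    simp only [Finset.mem_filter, Finset.mem_univ, true_and, Finset.mem_insert,
      Finset.mem_singleton, Prod.mk.injEq]
    constructor
    · rintro ⟨hne, h⟩
      rcases transRefl_inj hne h with h | h
      · exact Or.inl h
      · exact Or.inr h
    · rintro (⟨rfl, rfl, rfl⟩ | ⟨rfl, rfl, rfl⟩)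
      · exact ⟨hij, rfl⟩
      · exact ⟨hij.symm, (transRefl_symm _ _ _ hij).symm⟩
  rw [this, Finset.card_pair (by simp [hij])]
  simp

end

/-- Connectivity of the graph of `X` together with the blocks of `b`. -/
def Conn (b : Fin n → ι) (X : Set (GW m n)) : Prop :=
  ∀ f : Fin n → Prop, (∀ x y, b x = b y → f x → f y) → (∀ t ∈ X, ∀ x, f x → f (t.perm x)) →
    ∀ x y, f x → f y

/-- Merge the block of `j` into the block of `i`. -/
noncomputable def mrg (b : Fin n → ι) (i j : Fin n) : Fin n → ι :=
  fun x => if b x = b j then b i else b x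

lemma mrg_eq_self {b : Fin n → ι} {i j : Fin n} (h : b i = b j) : mrg b i j = b := by
  funext x
  simp only [mrg]
  split_ifs with h1
  · rw [h1, h]
  · rfl

lemma conn_insert (b : Fin n → ι) (i j : Fin n) (c : ZMod m) (X : Set (GW m n)) :
    Conn b (insert (transRefl i j c) X) ↔ Conn (mrg b i j) X := by
  constructor
  · intro h f hf hX
    refine h f (fun x y hxy => hf x y (by simp [mrg, hxy])) ?_
    intro t ht x hx
    rcases ht with rfl | ht
    · simp only [transRefl]
      by_cases h1 : x = i
      · subst h1
        rw [Equiv.swap_apply_left]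
        exact hf _ _ (by simp [mrg]) hx
      · by_cases h2 : x = j
        · subst h2
          rw [Equiv.swap_apply_right]
          exact hf _ _ (by simp [mrg]) hx
        · rwa [Equiv.swap_apply_of_ne_of_ne h1 h2]
    · exact hX t ht x hx
  · intro h f hf hX
    refine h f ?_ (fun t ht => hX t (Or.inr ht))
    have hij : f i → f j := fun hi => by
      have := hX _ (Or.inl rfl) i hi
      simpa [transRefl] using this
    have hji : f j → f i := fun hi => by
      have := hX _ (Or.inl rfl) j hi
      simpa [transRefl] using this
    intro x y hxy hx
    simp only [mrg] at hxy
    split_ifs at hxy with h1 h2 h2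
    · exact hf x y (h1.trans h2.symm) hx
    · exact hf i y hxy (hji (hf x j h1 hx))
    · exact hf j y h2.symm (hij (hf x i hxy hx))
    · exact hf x y hxy hx

lemma setOf_mem_cons {X : Type*} (t : X) (L : List X) :
    {x | x ∈ t :: L} = insert t {x | x ∈ L} := by
  ext x
  simp

lemma card_image_mrg (b : Fin n → ι) (i j : Fin n) :
    (Finset.univ.image b).card ≤ (Finset.univ.image (mrg b i j)).card + 1 := by
  have : Finset.univ.image b ⊆ insert (b j) (Finset.univ.image (mrg b i j)) := by
    intro a ha
    obtain ⟨x, -, rfl⟩ := Finset.mem_image.1 ha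
    by_cases h : b x = b j
    · rw [h]; exact Finset.mem_insert_self _ _
    · refine Finset.mem_insert_of_mem (Finset.mem_image.2 ⟨x, Finset.mem_univ _, ?_⟩)
      simp [mrg, h]
  exact (Finset.card_le_card this).trans (Finset.card_insert_le _ _)

lemma conn_card (L : List (GW m n)) (hL : ∀ t ∈ L, ∃ i j c, i ≠ j ∧ t = transRefl i j c)
    (b : Fin n → ι) (h : Conn b {t | t ∈ L}) :
    (Finset.univ.image b).card ≤ L.length + 1 := by
  induction L generalizing b with
  | nil =>
    simp only [List.length_nil, zero_add]
    rw [Finset.card_le_one]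
    intro a ha a' ha'
    obtain ⟨x, -, rfl⟩ := Finset.mem_image.1 ha
    obtain ⟨y, -, rfl⟩ := Finset.mem_image.1 ha'
    exact (h (fun z => b z = b x) (fun u v huv hu => huv ▸ hu) (by simp) x y rfl).symm
  | cons t L ih =>
    obtain ⟨i, j, c, hij, rfl⟩ := hL t (by simp)
    rw [setOf_mem_cons, conn_insert] at h
    have h1 := ih (fun t ht => hL t (by simp [ht])) _ h
    have h2 := card_image_mrg b i j
    simp only [List.length_cons]
    omega

/-- Block sizes. -/
noncomputable def lam (b : Fin n → ι) (a : ι) : ℚ :=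
  ((Finset.univ.filter (fun x => b x = a)).card : ℚ)

lemma image_mrg (b : Fin n → ι) (i j : Fin n) (h : b i ≠ b j) :
    Finset.univ.image (mrg b i j) = (Finset.univ.image b).erase (b j) := by
  ext a
  simp only [Finset.mem_image, Finset.mem_univ, true_and, Finset.mem_erase]
  constructor
  · rintro ⟨x, rfl⟩
    simp only [mrg]
    split_ifs with h1
    · exact ⟨h, i, rfl⟩
    · exact ⟨h1, x, rfl⟩
  · rintro ⟨h1, x, rfl⟩
    exact ⟨x, by simp [mrg, h1]⟩

lemma lam_mrg (b : Fin n → ι) (i j : Fin n) (h : b i ≠ b j) (a : ι) (ha : a ≠ b j) :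
    lam (mrg b i j) a = mergeW (lam b) (b i) (b j) a := by
  unfold lam mergeW
  by_cases h1 : a = b i
  · subst h1
    rw [Function.update_self, ← Nat.cast_add, ← Finset.card_union_of_disjoint]
    · congr 2
      ext x
      simp only [Finset.mem_filter, Finset.mem_univ, true_and, Finset.mem_union]
      simp only [mrg]
      split_ifs with h2
      · simp [h2]
      · simp [h2]
    · rw [Finset.disjoint_left]
      intro x hx hx'
      simp only [Finset.mem_filter, Finset.mem_univ, true_and] at hx hx'
      exact h (hx.symm.trans hx')
  · rw [Function.update_of_ne h1]
    congr 2
    ext x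
    simp only [Finset.mem_filter, Finset.mem_univ, true_and]
    simp only [mrg]
    split_ifs with h2
    · rw [h2]
      exact ⟨fun h => absurd h.symm h1, fun h => absurd h.symm ha⟩
    · rfl

lemma sum_lam (b : Fin n → ι) : ∑ a ∈ Finset.univ.image b, lam b a = n := by
  have := Finset.sum_comp (s := (Finset.univ : Finset (Fin n))) (fun _ : ι => (1 : ℚ)) b
  simp only [nsmul_eq_mul, mul_one, Finset.sum_const, Finset.card_univ, Fintype.card_fin] at this
  exact this.symm

lemma sum_blocks (b : Fin n → ι) (G : ι → ι → ℚ) :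
    ∑ i, ∑ j, G (b i) (b j)
      = ∑ a ∈ Finset.univ.image b, ∑ c ∈ Finset.univ.image b, lam b a * lam b c * G a c := by
  rw [Finset.sum_comp (s := (Finset.univ : Finset (Fin n))) (fun a => ∑ j, G a (b j)) b]
  refine Finset.sum_congr rfl fun a _ => ?_
  rw [Finset.sum_comp (s := (Finset.univ : Finset (Fin n))) (fun c => G a c) b, Finset.smul_sum]
  refine Finset.sum_congr rfl fun c _ => ?_
  simp only [nsmul_eq_mul, lam]
  ring

lemma sum_blocks_ne (b : Fin n → ι) (G : ι → ι → ℚ) :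
    ∑ i, ∑ j, (if b i ≠ b j then G (b i) (b j) else 0)
      = ∑ a ∈ Finset.univ.image b, ∑ c ∈ (Finset.univ.image b).erase a,
          lam b a * lam b c * G a c := by
  rw [sum_blocks b (fun a c => if a ≠ c then G a c else 0)]
  refine Finset.sum_congr rfl fun a ha => ?_
  rw [← Finset.add_sum_erase _ _ ha]
  simp only [ne_eq, not_true_eq_false, if_false, mul_zero, zero_add]
  refine Finset.sum_congr rfl fun c hc => ?_
  rw [if_pos (Finset.mem_erase.1 hc).1.symm]

lemma sum_blocks_eq (b : Fin n → ι) :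
    ∑ i, ∑ j, (if i ≠ j ∧ b i = b j then (1 : ℚ) else 0)
      = ∑ a ∈ Finset.univ.image b, (lam b a ^ 2 - lam b a) := by
  have h1 : ∑ i, ∑ j, (if i ≠ j ∧ b i = b j then (1 : ℚ) else 0)
      = ∑ i, ∑ j, (if b i = b j then (1 : ℚ) else 0) - ∑ i : Fin n, ∑ j, (if i = j then (1 : ℚ) else 0) := by
    rw [← Finset.sum_sub_distrib]
    refine Finset.sum_congr rfl fun i _ => ?_
    rw [← Finset.sum_sub_distrib]
    refine Finset.sum_congr rfl fun j _ => ?_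
    by_cases h : i = j
    · simp [h]
    · simp [h]
  rw [h1, sum_blocks b (fun a c => if a = c then 1 else 0), Finset.sum_sub_distrib, sum_lam]
  congr 1
  · refine Finset.sum_congr rfl fun a ha => ?_
    simp only [mul_ite, mul_one, mul_zero]
    rw [Finset.sum_ite_eq, if_pos ha]
    ring
  · simp

section
variable [NeZero m]

lemma tree_count (q : ℕ) (b : Fin n → ι) (hb : (Finset.univ.image b).card = q + 1) :
    (n : ℚ) * cnt (transFin m n) q (fun L => Conn b {t | t ∈ L})
      = (q.factorial : ℚ) * (m : ℚ) ^ q * (n : ℚ) ^ q * ∏ a ∈ Finset.univ.image b, lam b a := by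
  induction q generalizing b with
  | zero =>
    obtain ⟨a, ha⟩ := Finset.card_eq_one.1 hb
    have hs := sum_lam b
    rw [ha] at hs ⊢
    have hc : Conn b {t : GW m n | t ∈ ([] : List (GW m n))} := by
      intro f hf _ x y
      refine hf x y ?_
      have hx : b x ∈ Finset.univ.image b := Finset.mem_image_of_mem _ (Finset.mem_univ _)
      have hy : b y ∈ Finset.univ.image b := Finset.mem_image_of_mem _ (Finset.mem_univ _)
      rw [ha, Finset.mem_singleton] at hx hy
      rw [hx, hy]
    rw [Finset.sum_singleton] at hs
    simp only [cnt, if_pos hc, Finset.prod_singleton, hs]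
    simp
  | succ q ih =>
    have h2 := two_sum_trans (m := m) (n := n)
      (fun t => cnt (transFin m n) q (fun L => Conn b {x | x ∈ t :: L}))
    have h3 : (n : ℚ) * ∑ i, ∑ j, ∑ c : ZMod m, (if i ≠ j then
        cnt (transFin m n) q (fun L => Conn b {x | x ∈ transRefl i j c :: L}) else 0)
        = ∑ i, ∑ j, (if b i ≠ b j then (m : ℚ) * ((q.factorial : ℚ) * (m : ℚ) ^ q * (n : ℚ) ^ q *
          ∏ a ∈ (Finset.univ.image b).erase (b j), mergeW (lam b) (b i) (b j) a) else 0) := by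
      rw [Finset.mul_sum]
      refine Finset.sum_congr rfl fun i _ => ?_
      rw [Finset.mul_sum]
      refine Finset.sum_congr rfl fun j _ => ?_
      simp only [setOf_mem_cons, conn_insert]
      by_cases hbij : b i = b j
      · rw [mrg_eq_self hbij, cnt_false]
        · simp [hbij]
        · intro L hL hA hC
          have := conn_card L (fun t ht => mem_transFin.1 (hA t ht)) b hC
          omega
      · have hij : i ≠ j := fun h => hbij (h ▸ rfl)
        rw [if_pos hij, if_pos hbij, Finset.sum_const, Finset.card_univ, ZMod.card, nsmul_eq_mul]
        have hI := image_mrg b i j hbij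
        have := ih (mrg b i j) (by
          rw [hI, Finset.card_erase_of_mem (Finset.mem_image_of_mem _ (Finset.mem_univ _)), hb]
          rfl)
        rw [mul_left_comm, this, hI]
        congr 2
        refine Finset.prod_congr rfl fun a ha => ?_
        exact lam_mrg b i j hbij a (Finset.mem_erase.1 ha).1
    rw [← h2] at h3
    rw [sum_blocks_ne b (fun x y => (m : ℚ) * ((q.factorial : ℚ) * (m : ℚ) ^ q * (n : ℚ) ^ q *
          ∏ a ∈ (Finset.univ.image b).erase y, mergeW (lam b) x y a))] at h3
    have h4 : ∑ a ∈ Finset.univ.image b, ∑ c ∈ (Finset.univ.image b).erase a,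
          lam b a * lam b c * ((m : ℚ) * ((q.factorial : ℚ) * (m : ℚ) ^ q * (n : ℚ) ^ q *
          ∏ z ∈ (Finset.univ.image b).erase c, mergeW (lam b) a c z))
        = ((m : ℚ) * ((q.factorial : ℚ) * (m : ℚ) ^ q * (n : ℚ) ^ q) *
          ∏ z ∈ Finset.univ.image b, lam b z) *
          ∑ a ∈ Finset.univ.image b, ∑ c ∈ (Finset.univ.image b).erase a, (lam b a + lam b c) := by
      rw [Finset.mul_sum]
      refine Finset.sum_congr rfl fun a ha => ?_
      rw [Finset.mul_sum]
      refine Finset.sum_congr rfl fun c hc => ?_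
      have hc := Finset.mem_erase.1 hc
      linear_combination ((m : ℚ) * ((q.factorial : ℚ) * (m : ℚ) ^ q * (n : ℚ) ^ q)) *
        prod_mergeW ha hc.2 hc.1.symm (lam b)
    rw [h4, sum_pair_add, sum_lam, hb] at h3
    simp only [cnt]
    rw [Nat.factorial_succ]
    push_cast at h3 ⊢
    linear_combination h3 / 2

end

end RGSCount

open scoped Classical

namespace RGSCount

open GW

variable {m n : ℕ} {ι : Type*}

/-- `c` generates `ℤ/mℤ`. -/
def IsGen (c : ZMod m) : Prop := AddSubgroup.closure ({c} : Set (ZMod m)) = ⊤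

lemma isGen_iff (c : ZMod m) : IsGen c ↔ IsUnit c := by
  unfold IsGen
  rw [← AddSubgroup.zmultiples_eq_closure]
  constructor
  · intro h
    have : (1 : ZMod m) ∈ AddSubgroup.zmultiples c := by rw [h]; trivial
    obtain ⟨k, hk⟩ := AddSubgroup.mem_zmultiples_iff.1 this
    rw [zsmul_eq_mul] at hk
    exact IsUnit.of_mul_eq_one_right _ hk
  · rintro ⟨u, rfl⟩
    rw [AddSubgroup.eq_top_iff']
    intro x
    obtain ⟨k, hk⟩ := ZMod.intCast_surjective (x * ((u⁻¹ : (ZMod m)ˣ) : ZMod m))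
    refine AddSubgroup.mem_zmultiples_iff.2 ⟨k, ?_⟩
    rw [zsmul_eq_mul, hk, mul_assoc, Units.inv_mul, mul_one]

lemma card_gen [NeZero m] :
    (Finset.univ.filter (fun c : ZMod m => IsGen c)).card = Nat.totient m := by
  rw [← ZMod.card_units_eq_totient, ← Finset.card_univ,
    ← Finset.card_image_of_injective (Finset.univ : Finset (ZMod m)ˣ) Units.val_injective]
  congr 1
  ext c
  simp only [Finset.mem_filter, Finset.mem_univ, true_and, Finset.mem_image, isGen_iff]
  rfl

lemma card_gen_shift [NeZero m] (d : ZMod m) :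
    ∑ c : ZMod m, (if IsGen (c - d) then (1 : ℚ) else 0) = Nat.totient m := by
  have := Equiv.sum_comp (Equiv.subRight d) (fun c : ZMod m => if IsGen c then (1 : ℚ) else 0)
  simp only [Equiv.subRight_apply] at this
  rw [this, ← card_gen (m := m)]
  simp

/-- Elements whose colors agree modulo `D` with the coboundary of `h`. -/
def KK (D : AddSubgroup (ZMod m)) (h : Fin n → ZMod m) : Subgroup (GW m n) where
  carrier := {x | ∀ k, x.col k - (h (x.perm k) - h k) ∈ D}
  one_mem' := by intro k; simp
  mul_mem' := by
    intro a b ha hb k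
    have h1 := D.add_mem (ha (b.perm k)) (hb k)
    simp only [mul_col, mul_perm, Equiv.Perm.mul_apply]
    convert h1 using 1
    ring
  inv_mem' := by
    intro a ha k
    have h1 := D.neg_mem (ha (a.perm⁻¹ k))
    simp only [inv_col, inv_perm]
    convert h1 using 1
    have e : a.perm (a.perm⁻¹ k) = k := by simp
    rw [e]
    ring

lemma mem_KK {D : AddSubgroup (ZMod m)} {h : Fin n → ZMod m} {x : GW m n} :
    x ∈ KK D h ↔ ∀ k, x.col k - (h (x.perm k) - h k) ∈ D := Iff.rfl

lemma trans_mem_KK {D : AddSubgroup (ZMod m)} {h : Fin n → ZMod m} {i j : Fin n} (hij : i ≠ j)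
    (c : ZMod m) : transRefl i j c ∈ KK D h ↔ c - (h j - h i) ∈ D := by
  rw [mem_KK]
  constructor
  · intro H
    simpa [transRefl] using H i
  · intro H k
    simp only [transRefl]
    by_cases h1 : k = i
    · subst h1
      simpa using H
    · by_cases h2 : k = j
      · subst h2
        have := D.neg_mem H
        rw [Equiv.swap_apply_right, if_neg h1, if_pos rfl]
        convert this using 1
        ring
      · simp [h1, h2, Equiv.swap_apply_of_ne_of_ne h1 h2]

/-- the second potential agrees with `h` modulo `D` and constants on blocks. -/
def Phi (b : Fin n → ι) (h : Fin n → ZMod m) (D : AddSubgroup (ZMod m)) (h' : Fin n → ZMod m) :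
    Prop := ∀ x y, b x = b y → (h' x - h x) - (h' y - h y) ∈ D

/-- Only the full group of colors admits a potential compatible with `X`. -/
def Hol (b : Fin n → ι) (h : Fin n → ZMod m) (X : Set (GW m n)) : Prop :=
  ∀ D h', Phi b h D h' → (∀ t ∈ X, t ∈ KK D h') → D = ⊤

/-- Shift of the potential on the block of `j`. -/
noncomputable def shf (b : Fin n → ι) (h : Fin n → ZMod m) (i j : Fin n) (c : ZMod m) :
    Fin n → ZMod m := fun x => if b x = b j then h x + (c - (h j - h i)) else h x

lemma phi_mrg (b : Fin n → ι) (h : Fin n → ZMod m) {i j : Fin n} (hb : b i ≠ b j) (c : ZMod m)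
    (D : AddSubgroup (ZMod m)) (h' : Fin n → ZMod m) :
    Phi (mrg b i j) (shf b h i j c) D h' ↔ Phi b h D h' ∧ transRefl i j c ∈ KK D h' := by
  have hij : i ≠ j := fun h => hb (h ▸ rfl)
  rw [trans_mem_KK hij]
  constructor
  · intro H
    constructor
    · intro x y hxy
      have := H x y (by simp [mrg, hxy])
      simp only [shf, hxy] at this
      split_ifs at this with h1
      · convert this using 1
        ring
      · exact this
    · have := H i j (by simp [mrg])
      simp only [shf, if_neg hb, if_true] at this
      convert this using 1
      ring
  · rintro ⟨H, hc⟩ x y hxy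
    simp only [mrg] at hxy
    simp only [shf]
    split_ifs at hxy ⊢ with h1 h2 h2
    · convert H x y (h1.trans h2.symm) using 1
      ring
    · convert D.add_mem (D.sub_mem (H x j h1) hc) (H i y hxy) using 1
      ring
    · convert D.add_mem (D.add_mem (H x i hxy) hc) (H j y h2.symm) using 1
      ring
    · exact H x y hxy

lemma hol_insert (b : Fin n → ι) (h : Fin n → ZMod m) {i j : Fin n} (hb : b i ≠ b j) (c : ZMod m)
    (X : Set (GW m n)) :
    Hol b h (insert (transRefl i j c) X) ↔ Hol (mrg b i j) (shf b h i j c) X := by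
  constructor
  · intro H D h' hP hX
    rw [phi_mrg b h hb] at hP
    refine H D h' hP.1 ?_
    rintro t (rfl | ht)
    · exact hP.2
    · exact hX t ht
  · intro H D h' hP hX
    refine H D h' ((phi_mrg b h hb c D h').2 ⟨hP, hX _ (Or.inl rfl)⟩) fun t ht => hX t (Or.inr ht)

lemma hol_of_gen (b : Fin n → ι) (h : Fin n → ZMod m) {i j : Fin n} (hij : i ≠ j) (hb : b i = b j)
    (c : ZMod m) (hc : IsGen (c - (h j - h i))) (X : Set (GW m n)) :
    Hol b h (insert (transRefl i j c) X) := by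
  intro D h' hP hX
  have h1 := (trans_mem_KK hij c).1 (hX _ (Or.inl rfl))
  have h2 := hP i j hb
  have h3 : c - (h j - h i) ∈ D := by
    convert D.sub_mem h1 h2 using 1
    ring
  unfold IsGen at hc
  rw [eq_top_iff, ← hc, AddSubgroup.closure_le]
  simpa using h3

lemma forest_pot (L : List (GW m n)) (hL : ∀ t ∈ L, ∃ i j c, i ≠ j ∧ t = transRefl i j c)
    (b : Fin n → ι) (h : Fin n → ZMod m) (hC : Conn b {t | t ∈ L})
    (hcard : L.length + 1 ≤ (Finset.univ.image b).card) :
    ∃ h', Phi b h ⊥ h' ∧ ∀ t ∈ L, t ∈ KK ⊥ h' := by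
  induction L generalizing b h with
  | nil => exact ⟨h, fun x y _ => by simp, by simp⟩
  | cons t L ih =>
    obtain ⟨i, j, c, hij, rfl⟩ := hL t (by simp)
    have hL' : ∀ t ∈ L, ∃ i j c, i ≠ j ∧ t = transRefl i j c := fun t ht => hL t (by simp [ht])
    rw [setOf_mem_cons, conn_insert] at hC
    simp only [List.length_cons] at hcard
    have hb : b i ≠ b j := by
      intro hb
      rw [mrg_eq_self hb] at hC
      have := conn_card L hL' b hC
      omega
    have h2 := card_image_mrg b i j
    obtain ⟨h', hP, hK⟩ := ih hL' _ (shf b h i j c) hC (by omega)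
    rw [phi_mrg b h hb] at hP
    refine ⟨h', hP.1, ?_⟩
    intro t ht
    rcases List.mem_cons.1 ht with rfl | ht
    · exact hP.2
    · exact hK t ht

lemma KK_mono {D D' : AddSubgroup (ZMod m)} (hD : D ≤ D') (h : Fin n → ZMod m) :
    (KK D h : Subgroup (GW m n)) ≤ KK D' h := fun _ hx k => hD (hx k)

lemma not_hol_of_not_gen (b : Fin n → ι) (h : Fin n → ZMod m) {i j : Fin n} (hij : i ≠ j)
    (hb : b i = b j) (c : ZMod m) (hc : ¬ IsGen (c - (h j - h i)))
    (L : List (GW m n)) (hL : ∀ t ∈ L, ∃ i j c, i ≠ j ∧ t = transRefl i j c)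
    (hC : Conn b {t | t ∈ L}) (hcard : L.length + 1 ≤ (Finset.univ.image b).card) :
    ¬ Hol b h (insert (transRefl i j c) {t | t ∈ L}) := by
  intro H
  obtain ⟨h', hP, hK⟩ := forest_pot L hL b h hC hcard
  apply hc
  refine H (AddSubgroup.closure {c - (h j - h i)}) h' ?_ ?_
  · intro x y hxy
    exact (bot_le : (⊥ : AddSubgroup (ZMod m)) ≤ _) (hP x y hxy)
  · rintro t (rfl | ht)
    · rw [trans_mem_KK hij]
      have h1 := hP i j hb
      rw [AddSubgroup.mem_bot] at h1
      have : c - (h' j - h' i) = c - (h j - h i) := by linear_combination h1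
      rw [this]
      exact AddSubgroup.subset_closure rfl
    · exact KK_mono bot_le h' (hK t ht)

lemma cond_card (hm : 2 ≤ m) (L : List (GW m n))
    (hL : ∀ t ∈ L, ∃ i j c, i ≠ j ∧ t = transRefl i j c)
    (b : Fin n → ι) (h : Fin n → ZMod m) (hC : Conn b {t | t ∈ L}) (hH : Hol b h {t | t ∈ L}) :
    (Finset.univ.image b).card ≤ L.length := by
  by_contra hcon
  obtain ⟨h', hP, hK⟩ := forest_pot L hL b h hC (by omega)
  have h1 := hH ⊥ h' hP hK
  haveI : Fact (1 < m) := ⟨by omega⟩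
  exact bot_ne_top h1

lemma uni_count [NeZero m] (hn : 1 ≤ n) (q : ℕ) (b : Fin n → ι) (h : Fin n → ZMod m)
    (hb : (Finset.univ.image b).card = q) :
    2 * cnt (transFin m n) q (fun L => Conn b {t | t ∈ L} ∧ Hol b h {t | t ∈ L})
      = (q.factorial : ℚ) * (Nat.totient m : ℚ) * (m : ℚ) ^ (q - 1) *
        Vf (Finset.univ.image b) (lam b) q n * ∏ a ∈ Finset.univ.image b, lam b a := by
  have hn0 : (n : ℚ) ≠ 0 := by
    have : n ≠ 0 := by omega
    exact_mod_cast this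
  induction q generalizing b h with
  | zero =>
    exfalso
    rw [Finset.card_eq_zero, Finset.image_eq_empty] at hb
    have : (⟨0, hn⟩ : Fin n) ∈ (∅ : Finset (Fin n)) := hb ▸ Finset.mem_univ _
    simp at this
  | succ q ih =>
    have h2 := two_sum_trans (m := m) (n := n) (fun t => cnt (transFin m n) q (fun L =>
      Conn b {x | x ∈ t :: L} ∧ Hol b h {x | x ∈ t :: L}))
    have hT := tree_count (m := m) q b hb
    set T := cnt (transFin m n) q (fun L => Conn b {t | t ∈ L}) with hTdef
    have h3 : 2 * ∑ i, ∑ j, ∑ c : ZMod m, (if i ≠ j then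
        cnt (transFin m n) q (fun L => Conn b {x | x ∈ transRefl i j c :: L} ∧
          Hol b h {x | x ∈ transRefl i j c :: L}) else 0)
        = ∑ i, ∑ j, (if b i ≠ b j then (m : ℚ) * ((q.factorial : ℚ) * (Nat.totient m : ℚ) *
          (m : ℚ) ^ (q - 1) * Vf ((Finset.univ.image b).erase (b j))
            (mergeW (lam b) (b i) (b j)) q n *
          ∏ a ∈ (Finset.univ.image b).erase (b j), mergeW (lam b) (b i) (b j) a) else 0)
        + 2 * (Nat.totient m : ℚ) * T * ∑ i, ∑ j, (if i ≠ j ∧ b i = b j then (1 : ℚ) else 0) := by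
      rw [Finset.mul_sum, Finset.mul_sum, ← Finset.sum_add_distrib]
      refine Finset.sum_congr rfl fun i _ => ?_
      rw [Finset.mul_sum, Finset.mul_sum, ← Finset.sum_add_distrib]
      refine Finset.sum_congr rfl fun j _ => ?_
      simp only [setOf_mem_cons, conn_insert]
      by_cases hbij : b i = b j
      · by_cases hij : i = j
        · simp [hij]
        · have key : ∀ c : ZMod m, cnt (transFin m n) q (fun L => Conn (mrg b i j) {x | x ∈ L} ∧
              Hol b h (insert (transRefl i j c) {x | x ∈ L}))
              = T * (if IsGen (c - (h j - h i)) then (1 : ℚ) else 0) := by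
            intro c
            rw [mrg_eq_self hbij]
            by_cases hg : IsGen (c - (h j - h i))
            · rw [if_pos hg, mul_one, hTdef]
              apply cnt_congr
              intro L _ _
              exact and_iff_left (hol_of_gen b h hij hbij c hg _)
            · rw [if_neg hg, mul_zero]
              apply cnt_false
              rintro L hL hA ⟨hC, hH⟩
              exact not_hol_of_not_gen b h hij hbij c hg L
                (fun t ht => mem_transFin.1 (hA t ht)) hC (by omega) hH
          simp only [key]
          rw [if_neg (by simpa using hbij), if_pos ⟨hij, hbij⟩]
          simp only [ne_eq, hij, not_false_eq_true, if_true]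
          rw [← Finset.mul_sum, card_gen_shift]
          ring
      · have hij : i ≠ j := fun h => hbij (h ▸ rfl)
        have hI := image_mrg b i j hbij
        have hcI : (Finset.univ.image (mrg b i j)).card = q := by
          rw [hI, Finset.card_erase_of_mem (Finset.mem_image_of_mem _ (Finset.mem_univ _)), hb]
          rfl
        have hlam : ∀ a ∈ (Finset.univ.image b).erase (b j),
            lam (mrg b i j) a = mergeW (lam b) (b i) (b j) a := fun a ha =>
          lam_mrg b i j hbij a (Finset.mem_erase.1 ha).1
        have key : ∀ c : ZMod m, 2 * cnt (transFin m n) q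
            (fun L => Conn (mrg b i j) {x | x ∈ L} ∧
              Hol b h (insert (transRefl i j c) {x | x ∈ L}))
            = (q.factorial : ℚ) * (Nat.totient m : ℚ) *
          (m : ℚ) ^ (q - 1) * Vf ((Finset.univ.image b).erase (b j))
            (mergeW (lam b) (b i) (b j)) q n *
          ∏ a ∈ (Finset.univ.image b).erase (b j), mergeW (lam b) (b i) (b j) a := by
          intro c
          simp only [hol_insert b h hbij]
          rw [ih (mrg b i j) (shf b h i j c) hcI, hI]
          congr 1
          · congr 1
            unfold Vf
            congr 1
            refine Finset.sum_congr rfl fun z _ => ?_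
            rw [es_congr hlam]
          · exact Finset.prod_congr rfl hlam
        rw [if_pos hbij, if_neg (by tauto)]
        simp only [ne_eq, hij, not_false_eq_true, if_true]
        rw [Finset.mul_sum]
        simp only [key]
        rw [Finset.sum_const, Finset.card_univ, ZMod.card, nsmul_eq_mul]
        ring
    rw [← h2] at h3
    rw [sum_blocks_ne b (fun x y => (m : ℚ) * ((q.factorial : ℚ) * (Nat.totient m : ℚ) *
          (m : ℚ) ^ (q - 1) * Vf ((Finset.univ.image b).erase y)
            (mergeW (lam b) x y) q n *
          ∏ a ∈ (Finset.univ.image b).erase y, mergeW (lam b) x y a)), sum_blocks_eq] at h3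
    have h4 : ∑ a ∈ Finset.univ.image b, ∑ c ∈ (Finset.univ.image b).erase a,
          lam b a * lam b c * ((m : ℚ) * ((q.factorial : ℚ) * (Nat.totient m : ℚ) *
          (m : ℚ) ^ (q - 1) * Vf ((Finset.univ.image b).erase c)
            (mergeW (lam b) a c) q n *
          ∏ z ∈ (Finset.univ.image b).erase c, mergeW (lam b) a c z))
        = ((m : ℚ) * ((q.factorial : ℚ) * (Nat.totient m : ℚ) * (m : ℚ) ^ (q - 1)) *
          ∏ z ∈ Finset.univ.image b, lam b z) *
          ∑ a ∈ Finset.univ.image b, ∑ c ∈ (Finset.univ.image b).erase a, (lam b a + lam b c) *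
            Vf ((Finset.univ.image b).erase c) (mergeW (lam b) a c) q n := by
      rw [Finset.mul_sum]
      refine Finset.sum_congr rfl fun a ha => ?_
      rw [Finset.mul_sum]
      refine Finset.sum_congr rfl fun c hc => ?_
      have hc := Finset.mem_erase.1 hc
      linear_combination ((m : ℚ) * ((q.factorial : ℚ) * (Nat.totient m : ℚ) *
        (m : ℚ) ^ (q - 1)) * Vf ((Finset.univ.image b).erase c) (mergeW (lam b) a c) q n) *
        prod_mergeW ha hc.2 hc.1.symm (lam b)
    rw [h4] at h3
    simp only [cnt]
    have hs := sum_lam b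
    cases q with
    | zero =>
      obtain ⟨a, ha⟩ := Finset.card_eq_one.1 hb
      rw [ha] at h3 hT hs ⊢
      simp only [Finset.sum_singleton, Finset.prod_singleton] at h3 hT hs ⊢
      rw [hs] at h3 hT ⊢
      have hT1 : T = 1 := by
        apply mul_left_cancel₀ hn0
        rw [hT]
        simp
      rw [hT1] at h3
      simp only [Finset.erase_singleton, Finset.sum_empty, mul_zero, zero_add, mul_one] at h3
      simp only [Vf, Nat.factorial_one, zero_add]
      simp only [Nat.sub_self, pow_zero, pow_one, Finset.range_zero, Finset.sum_empty]
      push_cast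
      linear_combination h3 / 2
    | succ r =>
      have hV := Vf_rec (Finset.univ.image b) (lam b) r hb n hs
      have hT' : T = ((r + 1).factorial : ℚ) * (m : ℚ) ^ (r + 1) * (n : ℚ) ^ r *
          ∏ a ∈ Finset.univ.image b, lam b a := by
        apply mul_left_cancel₀ hn0
        rw [hT]
        ring
      rw [hT'] at h3
      simp only [Nat.add_sub_cancel] at h3 ⊢
      rw [Nat.factorial_succ (r + 1)]
      push_cast
      rw [show r + 1 + 1 = r + 2 from rfl]
      linear_combination h3 / 2 - ((r + 1).factorial : ℚ) * (Nat.totient m : ℚ) *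
        (m : ℚ) ^ (r + 1) * (∏ a ∈ Finset.univ.image b, lam b a) / 2 * hV

end RGSCount

open scoped Classical

namespace RGSCount

open GW

variable {m n : ℕ} {ι : Type*}

lemma pow_perm (g : GW m n) (d : ℕ) : (g ^ d).perm = g.perm ^ d := by
  induction d with
  | zero => rfl
  | succ d ih => rw [pow_succ, pow_succ, mul_perm, ih]

lemma pow_col (g : GW m n) (d : ℕ) (r : Fin n) :
    (g ^ d).col r = ∑ i ∈ Finset.range d, g.col ((g.perm ^ i) r) := by
  induction d with
  | zero => simp
  | succ d ih => rw [pow_succ', mul_col, ih, Finset.sum_range_succ, pow_perm, add_comm]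

lemma sameCycle_pow {u : Equiv.Perm (Fin n)} {x y : Fin n} (h : u.SameCycle x y) :
    ∃ s : ℕ, (u ^ s) x = y := by
  obtain ⟨s, -, hs⟩ := h.exists_pow_eq''
  exact ⟨s, hs.2⟩

lemma period_col (g : GW m n) (r : Fin n) :
    (g ^ (Function.minimalPeriod g.perm r)).col r = cycColor g r := by
  rw [pow_col, cycColor]
  refine Finset.sum_bij (fun i _ => (g.perm ^ i) r) ?_ ?_ ?_ ?_
  · intro i _
    simp only [orbit, Finset.mem_filter, Finset.mem_univ, true_and]
    exact ⟨i, by simp⟩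
  · intro i hi j hj hij
    simp only [Equiv.Perm.coe_pow] at hij
    exact Function.iterate_injOn_Iio_minimalPeriod (by simpa using hi) (by simpa using hj) hij
  · intro z hz
    simp only [orbit, Finset.mem_filter, Finset.mem_univ, true_and] at hz
    obtain ⟨s, hs⟩ := sameCycle_pow hz
    refine ⟨s % Function.minimalPeriod g.perm r, ?_, ?_⟩
    · rw [Finset.mem_range]
      refine Nat.mod_lt _ (Function.minimalPeriod_pos_of_mem_periodicPts ?_)
      exact (g.perm.injective.mem_periodicPts r)
    · rw [← hs, Equiv.Perm.coe_pow, Equiv.Perm.coe_pow, Function.iterate_mod_minimalPeriod_eq]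
  · intros; rfl

lemma pow_col_wd (g : GW m n) (r : Fin n) (hr : cycColor g r = 0) {s t : ℕ}
    (hst : (g.perm ^ s) r = (g.perm ^ t) r) : (g ^ s).col r = (g ^ t).col r := by
  set p := Function.minimalPeriod g.perm r with hp
  have hp0 : 0 < p := Function.minimalPeriod_pos_of_mem_periodicPts (g.perm.injective.mem_periodicPts r)
  have hfix : (g.perm ^ p) r = r := by
    rw [Equiv.Perm.coe_pow]; exact Function.iterate_minimalPeriod
  have key : ∀ q, (g ^ (p * q)).col r = 0 ∧ (g.perm ^ (p * q)) r = r := by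
    intro q
    induction q with
    | zero => simp
    | succ q ih =>
      constructor
      · rw [mul_add, mul_one, pow_add, mul_col, pow_perm, hfix, ih.1, period_col, hr, add_zero]
      · rw [mul_add, mul_one, pow_add, Equiv.Perm.mul_apply, hfix, ih.2]
  have red : ∀ s, (g ^ s).col r = (g ^ (s % p)).col r := by
    intro s
    conv_lhs => rw [← Nat.mod_add_div s p, pow_add, mul_col, pow_perm, (key _).1, (key _).2, add_zero]
  have : s % p = t % p := by
    simp only [Equiv.Perm.coe_pow] at hst
    rw [← Function.iterate_mod_minimalPeriod_eq (n := s), ← Function.iterate_mod_minimalPeriod_eq (n := t)] at hst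
    exact Function.iterate_injOn_Iio_minimalPeriod (Nat.mod_lt _ hp0) (Nat.mod_lt _ hp0) hst
  rw [red s, red t, this]

lemma cycColor_congr (g : GW m n) {x y : Fin n} (h : g.perm.SameCycle x y) :
    cycColor g x = cycColor g y := by
  unfold cycColor orbit
  congr 1
  ext z
  simp only [Finset.mem_filter, Finset.mem_univ, true_and]
  exact ⟨fun h' => h.symm.trans h', fun h' => h.trans h'⟩

lemma exists_pot (g : GW m n) (hg : ∀ z, cycColor g z = 0) : ∃ h, g ∈ KK ⊥ h := by
  let S : Setoid (Fin n) := Equiv.Perm.SameCycle.setoid g.perm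
  let r : Fin n → Fin n := fun z => (Quotient.mk S z).out
  have hr : ∀ z, g.perm.SameCycle (r z) z := fun z => Quotient.exact (Quotient.out_eq (Quotient.mk S z))
  have hr' : ∀ z, r (g.perm z) = r z := by
    intro z
    have : Quotient.mk S (g.perm z) = Quotient.mk S z := Quotient.sound (by
      show g.perm.SameCycle _ _
      exact (Equiv.Perm.sameCycle_apply_left.2 (Equiv.Perm.SameCycle.refl _ _)))
    simp only [r, this]
  choose s hs using fun z => sameCycle_pow (hr z)
  refine ⟨fun z => (g ^ (s z)).col (r z), ?_⟩
  intro k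
  rw [AddSubgroup.mem_bot]
  have h1 : (g ^ (s (g.perm k))).col (r k) = (g ^ (s k + 1)).col (r k) := by
    refine pow_col_wd g _ (hg _) ?_
    rw [pow_succ', Equiv.Perm.mul_apply, hs k, ← hr' k, hs]
  simp only [hr', h1]
  rw [pow_succ', mul_col, pow_perm, hs]
  ring

/-- Same permutation, colors changed at one point. -/
lemma diag_cycColor (g : GW m n) (x : Fin n) (a : ZMod m) (z : Fin n) :
    cycColor (g * diagRefl x a) z = cycColor g z + if g.perm.SameCycle z x then a else 0 := by
  unfold cycColor
  have : (g * diagRefl x a).perm = g.perm := by simp [diagRefl]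
  rw [this]
  have h2 : ∀ y, (g * diagRefl x a).col y = g.col y + if y = x then a else 0 := by
    intro y; simp [diagRefl]
  simp only [h2, Finset.sum_add_distrib, Finset.sum_ite_eq']
  simp [orbit]

/-- The space of invariant vectors. -/
noncomputable def VV [NeZero m] (x : GW m n) : Submodule ℂ (Fin n → ℂ) where
  carrier := {v | ∀ k, v (x.perm k) = ZMod.stdAddChar (x.col k) * v k}
  add_mem' := by
    intro v w hv hw k
    simp only [Set.mem_ofPred_eq] at hv hw
    simp only [Pi.add_apply, hv k, hw k, mul_add]
  zero_mem' := by intro k; simp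
  smul_mem' := by
    intro c v hv k
    simp only [Set.mem_ofPred_eq] at hv
    simp only [Pi.smul_apply, hv k, smul_eq_mul]
    ring

variable [NeZero m]

lemma mem_VV {x : GW m n} {v : Fin n → ℂ} :
    v ∈ VV x ↔ ∀ k, v (x.perm k) = ZMod.stdAddChar (x.col k) * v k := Iff.rfl

lemma mem_VV_mul {x y : GW m n} {v : Fin n → ℂ} (hx : v ∈ VV x) (hy : v ∈ VV y) :
    v ∈ VV (x * y) := by
  intro k
  rw [mul_perm, Equiv.Perm.mul_apply, mul_col, hx, hy, AddChar.map_add_eq_mul]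
  ring

lemma mem_VV_one (v : Fin n → ℂ) : v ∈ VV (1 : GW m n) := by
  intro k; simp

lemma mem_VV_pow {x : GW m n} {v : Fin n → ℂ} (hx : v ∈ VV x) (d : ℕ) : v ∈ VV (x ^ d) := by
  induction d with
  | zero => rw [pow_zero]; exact mem_VV_one v
  | succ d ih => rw [pow_succ]; exact mem_VV_mul ih hx

lemma mem_VV_prod {v : Fin n → ℂ} (l : List (GW m n)) (h : ∀ t ∈ l, v ∈ VV t) : v ∈ VV l.prod := by
  induction l with
  | nil => exact mem_VV_one v
  | cons t l ih =>
    rw [List.prod_cons]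
    exact mem_VV_mul (h t (by simp)) (ih fun t ht => h t (by simp [ht]))

lemma VV_zero_of_sameCycle {g : GW m n} {v : Fin n → ℂ} (hv : v ∈ VV g) {x z : Fin n}
    (h : g.perm.SameCycle x z) (hx : v x = 0) : v z = 0 := by
  obtain ⟨s, rfl⟩ := sameCycle_pow h
  have := mem_VV_pow hv s x
  rw [pow_perm] at this
  rw [this, hx, mul_zero]

lemma stdAddChar_ne_zero (a : ZMod m) : (ZMod.stdAddChar a : ℂ) ≠ 0 := by
  intro h
  have : (ZMod.stdAddChar (a + -a) : ℂ) = 0 := by rw [AddChar.map_add_eq_mul, h, zero_mul]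
  simp at this

lemma VV_zero_of_color {g : GW m n} {v : Fin n → ℂ} (hv : v ∈ VV g) {x : Fin n}
    (hc : cycColor g x ≠ 0) : v x = 0 := by
  have := mem_VV_pow hv (Function.minimalPeriod g.perm x) x
  rw [pow_perm, period_col] at this
  have hfix : (g.perm ^ (Function.minimalPeriod g.perm x)) x = x := by
    rw [Equiv.Perm.coe_pow]; exact Function.iterate_minimalPeriod
  rw [hfix] at this
  by_contra hne
  have h1 : (ZMod.stdAddChar (cycColor g x) : ℂ) = 1 := by
    have := mul_right_cancel₀ hne ((one_mul _).trans this)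
    exact this.symm
  apply hc
  apply ZMod.injective_stdAddChar
  rw [h1]; simp

/-- dimension of the common fixed space -/
lemma refl_codim {t : GW m n} (ht : t ∈ (reflG1 : Set (GW m n))) :
    ∃ f : (Fin n → ℂ) →ₗ[ℂ] ℂ, LinearMap.ker f ≤ VV t := by
  rcases ht with ⟨i, j, c, hij, rfl⟩ | ⟨i, c, hc, rfl⟩
  · refine ⟨LinearMap.proj j - (ZMod.stdAddChar c : ℂ) • LinearMap.proj i, ?_⟩
    intro v hv k
    have hv' : v j = ZMod.stdAddChar c * v i := by
      simpa [sub_eq_zero] using hv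
    simp only [transRefl]
    by_cases h1 : k = i
    · subst h1; simpa using hv'
    · by_cases h2 : k = j
      · subst h2
        rw [Equiv.swap_apply_right, if_neg h1, if_pos rfl, hv', ← mul_assoc,
          ← AddChar.map_add_eq_mul]
        simp
      · simp [h1, h2, Equiv.swap_apply_of_ne_of_ne h1 h2]
  · refine ⟨LinearMap.proj i, ?_⟩
    intro v hv k
    have hv' : v i = 0 := by simpa using hv
    simp only [diagRefl]
    by_cases h1 : k = i
    · subst h1; simp [hv']
    · simp [h1]

lemma inf_codim (l : List (GW m n)) (hl : ∀ t ∈ l, t ∈ (reflG1 : Set (GW m n))) :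
    ∃ U : Submodule ℂ (Fin n → ℂ), (∀ t ∈ l, U ≤ VV t) ∧ n ≤ Module.finrank ℂ U + l.length := by
  induction l with
  | nil => exact ⟨⊤, by simp, by simp⟩
  | cons t l ih =>
    obtain ⟨U, hU, hd⟩ := ih fun t ht => hl t (by simp [ht])
    obtain ⟨f, hf⟩ := refl_codim (hl t (by simp))
    refine ⟨U ⊓ LinearMap.ker f, ?_, ?_⟩
    · intro s hs
      rcases List.mem_cons.1 hs with rfl | hs
      · exact inf_le_right.trans hf
      · exact inf_le_left.trans (hU s hs)
    · have h1 := Submodule.finrank_sup_add_finrank_inf_eq U (LinearMap.ker f)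
      have h2 := LinearMap.finrank_range_add_finrank_ker f
      have h3 : Module.finrank ℂ (LinearMap.range f) ≤ 1 := by
        simpa using Submodule.finrank_le (LinearMap.range f)
      have h4 := Submodule.finrank_le (U ⊔ LinearMap.ker f)
      simp only [Module.finrank_fintype_fun_eq_card, Fintype.card_fin] at h2 h4
      simp only [List.length_cons]
      omega

lemma red_facts (R : Set (GW m n)) (hR : R ⊆ reflG1) (g : GW m n) (k : ℕ)
    (hV : Module.finrank ℂ (VV g) ≤ k) (l0 : List (GW m n)) (h0 : ∀ t ∈ l0, t ∈ R)
    (hp : l0.prod = g) (hlen : l0.length + k ≤ n) :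
    Comb.rLen R g = n - k ∧ l0 ∈ Comb.Red R g ∧
      ∀ l ∈ Comb.Red R g, ∀ t ∈ l, VV g ≤ VV t := by
  have lower : ∀ l : List (GW m n), (∀ t ∈ l, t ∈ R) → l.prod = g →
      n - k ≤ l.length ∧ (l.length = n - k → ∀ t ∈ l, VV g ≤ VV t) := by
    intro l hl hlp
    obtain ⟨U, hU, hd⟩ := inf_codim l fun t ht => hR (hl t ht)
    have hUg : U ≤ VV g := fun v hv => hlp ▸ mem_VV_prod l (fun t ht => hU t ht hv)
    have h1 := Submodule.finrank_mono hUg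
    refine ⟨by omega, fun he => ?_⟩
    have : U = VV g := Submodule.eq_of_le_of_finrank_le hUg (by omega)
    rw [← this]
    exact hU
  have hl0 : l0.length = n - k := by have := (lower l0 h0 hp).1; omega
  have hr : Comb.rLen R g = n - k := by
    apply le_antisymm
    · exact Nat.sInf_le ⟨l0, h0, hp, hl0⟩
    · refine le_csInf ⟨_, l0, h0, hp, rfl⟩ ?_
      rintro q ⟨l, hl, hlp, rfl⟩
      exact (lower l hl hlp).1
  refine ⟨hr, ⟨h0, hp, by rw [hl0, hr]⟩, ?_⟩
  rintro l ⟨hl, hlp, hll⟩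
  exact (lower l hl hlp).2 (by rw [hll, hr])

/-- Upper bound for the reflection length of an element with a potential. -/
lemma upper (h : Fin n → ZMod m) (q : ℕ) (g : GW m n) (hg : g ∈ KK ⊥ h)
    (hq : n ≤ Module.finrank ℂ (VV g) + q) :
    ∃ l : List (GW m n), (∀ t ∈ l, t ∈ (reflGmm : Set (GW m n))) ∧ l.prod = g ∧
      l.length + Module.finrank ℂ (VV g) ≤ n := by
  induction q generalizing g with
  | zero =>
    by_cases h1 : g = 1
    · subst h1
      refine ⟨[], by simp, by simp, ?_⟩
      simpa using Submodule.finrank_le (VV (1 : GW m n))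
    · exfalso
      have htop : VV g = ⊤ := Submodule.eq_top_of_finrank_eq (by
        have := Submodule.finrank_le (VV g)
        simp only [Module.finrank_fintype_fun_eq_card, Fintype.card_fin] at this ⊢
        omega)
      apply h1
      have hperm : g.perm = 1 := by
        ext x
        by_contra hne
        have : (Pi.single x 1 : Fin n → ℂ) ∈ VV g := by rw [htop]; trivial
        have := this x
        rw [Pi.single_eq_same, Pi.single_eq_of_ne (by intro h; apply hne; simp [h])] at this
        exact stdAddChar_ne_zero (g.col x) (by simpa using this.symm)
      ext x
      · simp [hperm]
      · have := hg x
        rw [hperm] at this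
        simpa using this
  | succ q ih =>
    by_cases hx : ∃ x, g.perm x ≠ x
    · obtain ⟨x, hx⟩ := hx
      set t : GW m n := transRefl x (g.perm x) (h (g.perm x) - h x) with ht
      have htR : t ∈ (reflGmm : Set (GW m n)) := ⟨_, _, _, hx.symm, rfl⟩
      have htK : t ∈ KK ⊥ h := (trans_mem_KK hx.symm _).2 (by simp)
      have htt : t * t = 1 := by
        ext k
        · simp [ht, transRefl]
        · simp only [ht, transRefl, mul_col, one_col]
          by_cases h1 : k = x
          · subst h1; simp [hx]
          · by_cases h2 : k = g.perm x
            · rw [h2]; simp [hx]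
            · simp [h1, h2, Equiv.swap_apply_of_ne_of_ne h1 h2]
      have hfix : (t * g).perm x = x := by simp [ht, transRefl]
      have hK := (KK ⊥ h).mul_mem htK hg
      have hcolx : (t * g).col x = 0 := by
        have := hK x
        rw [hfix] at this
        simpa using this
      have hle : VV g ≤ VV (t * g) := by
        intro v hv
        refine mem_VV_mul ?_ hv
        have h1 := hv x
        have h2 := hg x
        rw [AddSubgroup.mem_bot, sub_eq_zero] at h2
        rw [h2] at h1
        intro k
        simp only [ht, transRefl]
        by_cases h3 : k = x
        · subst h3; simpa using h1
        · by_cases h4 : k = g.perm x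
          · rw [h4, Equiv.swap_apply_right, if_neg hx, if_pos rfl, h1, ← mul_assoc,
              ← AddChar.map_add_eq_mul]
            simp
          · simp [h3, h4, Equiv.swap_apply_of_ne_of_ne h3 h4]
      have hlt : VV g < VV (t * g) := by
        refine lt_of_le_of_ne hle ?_
        intro he
        have h1 : (Pi.single x 1 : Fin n → ℂ) ∈ VV (t * g) := by
          intro k
          by_cases hk : k = x
          · subst hk
            rw [hfix, hcolx]; simp
          · have : (t * g).perm k ≠ x := by
              intro h'
              apply hk
              exact (t * g).perm.injective (h'.trans hfix.symm)
            rw [Pi.single_eq_of_ne this, Pi.single_eq_of_ne hk, mul_zero]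
        rw [← he] at h1
        have := h1 x
        rw [Pi.single_eq_same, Pi.single_eq_of_ne hx] at this
        exact stdAddChar_ne_zero (g.col x) (by simpa using this.symm)
      have hfr := Submodule.finrank_lt_finrank_of_lt hlt
      obtain ⟨l, hl, hlp, hll⟩ := ih (t * g) hK (by omega)
      refine ⟨t :: l, ?_, ?_, ?_⟩
      · intro s hs
        rcases List.mem_cons.1 hs with rfl | hs
        · exact htR
        · exact hl s hs
      · rw [List.prod_cons, hlp, ← mul_assoc, htt, one_mul]
      · simp only [List.length_cons]; omega
    · push Not at hx
      have h1 : g = 1 := by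
        ext x
        · simp [hx x]
        · have := hg x
          rw [hx x] at this
          simpa using this
      subst h1
      refine ⟨[], by simp, by simp, ?_⟩
      simpa using Submodule.finrank_le (VV (1 : GW m n))

/-- Standard invariant vectors. -/
noncomputable def vv (b : Fin n → ι) (h : Fin n → ZMod m) (a : ι) : Fin n → ℂ :=
  fun z => if b z = a then ZMod.stdAddChar (h z) else 0

lemma vv_mem {g : GW m n} {b : Fin n → ι} {h : Fin n → ZMod m} {a : ι}
    (hb : ∀ z, b (g.perm z) = b z) (hh : ∀ z, b z = a → g.col z = h (g.perm z) - h z) :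
    vv b h a ∈ VV g := by
  intro k
  simp only [vv, hb]
  split_ifs with h1
  · rw [hh k h1, ← AddChar.map_add_eq_mul, sub_add_cancel]
  · simp

lemma finrank_ge {g : GW m n} {b : Fin n → ι} {h : Fin n → ZMod m}
    (hb : ∀ z, b (g.perm z) = b z) (hg : g ∈ KK ⊥ h) :
    (Finset.univ.image b).card ≤ Module.finrank ℂ (VV g) := by
  have hmem : ∀ a, vv b h a ∈ VV g := fun a => vv_mem hb (fun z _ => by
    have := hg z
    rwa [AddSubgroup.mem_bot, sub_eq_zero] at this)
  have hli : LinearIndependent ℂ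
      (fun a : (Finset.univ.image b) => (⟨vv b h a, hmem a⟩ : VV g)) := by
    rw [Fintype.linearIndependent_iff]
    intro c hc a
    obtain ⟨z, -, hz⟩ := Finset.mem_image.1 a.2
    have := congrArg (fun v : VV g => (v : Fin n → ℂ) z) hc
    simp only [Submodule.coe_sum, Submodule.coe_smul, Finset.sum_apply, Pi.smul_apply,
      smul_eq_mul, vv, Submodule.coe_zero, Pi.zero_apply] at this
    rw [Finset.sum_eq_single a] at this
    · rw [if_pos hz] at this
      exact (mul_eq_zero.1 this).resolve_right (stdAddChar_ne_zero _)
    · intro a' _ hne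
      rw [if_neg, mul_zero]
      intro h'
      exact hne (Subtype.ext (h'.symm.trans hz))
    · simp
  simpa using hli.fintype_card_le_finrank

lemma finrank_le_of {g : GW m n} {k : ℕ} (y : Fin k → Fin n)
    (H : ∀ v ∈ VV g, (∀ i, v (y i) = 0) → v = 0) : Module.finrank ℂ (VV g) ≤ k := by
  let e : VV g →ₗ[ℂ] (Fin k → ℂ) :=
    { toFun := fun v i => (v : Fin n → ℂ) (y i)
      map_add' := fun _ _ => rfl
      map_smul' := fun _ _ => rfl }
  have hinj : Function.Injective e := by
    rw [← LinearMap.ker_eq_bot, LinearMap.ker_eq_bot']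
    intro v hv
    apply Subtype.ext
    exact H v v.2 fun i => congrFun hv i
  simpa using LinearMap.finrank_le_finrank_of_injective hinj

end RGSCount

open scoped Classical

namespace RGSCount

open GW

variable {m n : ℕ} {ι : Type*}

/-- Connectivity of the graph of `X`. -/
def Conn0 (X : Set (GW m n)) : Prop :=
  ∀ f : Fin n → Prop, (∀ t ∈ X, ∀ x, f x → f (t.perm x)) → ∀ x y, f x → f y

lemma inv_back {u : Equiv.Perm (Fin n)} {f : Fin n → Prop} (h : ∀ x, f x → f (u x)) (x : Fin n)
    (hx : f (u x)) : f x := by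
  have hp : ∀ s : ℕ, ∀ z, f z → f ((u ^ s) z) := by
    intro s
    induction s with
    | zero => intro z hz; simpa using hz
    | succ s ih =>
      intro z hz
      rw [pow_succ', Equiv.Perm.mul_apply]
      exact h _ (ih z hz)
  obtain ⟨s, hs⟩ := sameCycle_pow (u := u) (x := u x) (y := x)
    (Equiv.Perm.sameCycle_apply_left.2 (Equiv.Perm.SameCycle.refl _ _))
  rw [← hs]
  exact hp s _ hx

/-- The elements preserving `f`. -/
def stabF (f : Fin n → Prop) : Subgroup (GW m n) where
  carrier := {t | ∀ x, f x ↔ f (t.perm x)}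
  one_mem' := by intro x; simp
  mul_mem' := by
    intro a b ha hb x
    rw [mul_perm, Equiv.Perm.mul_apply]
    exact (hb x).trans (ha _)
  inv_mem' := by
    intro a ha x
    have := ha (a.perm⁻¹ x)
    have e : a.perm (a.perm⁻¹ x) = x := by simp
    rw [e] at this
    exact this.symm

lemma mem_stabF {f : Fin n → Prop} {t : GW m n} (h : ∀ x, f x → f (t.perm x)) : t ∈ stabF f :=
  fun x => ⟨h x, inv_back h x⟩

lemma conn0_of (X : Set (GW m n)) (h : ∀ i j : Fin n, i ≠ j →
    transRefl i j 0 ∈ Subgroup.closure X) : Conn0 X := by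
  intro f hf x y hx
  by_cases hxy : x = y
  · exact hxy ▸ hx
  have hle : Subgroup.closure X ≤ stabF f :=
    (Subgroup.closure_le _).2 fun t ht => mem_stabF (hf t ht)
  have := (hle (h x y hxy) x).1 hx
  simpa [transRefl] using this

/-- Total color. -/
def tot (x : GW m n) : ZMod m := ∑ k, x.col k

lemma tot_mul (x y : GW m n) : tot (x * y) = tot x + tot y := by
  simp only [tot, mul_col, Finset.sum_add_distrib]
  rw [Equiv.sum_comp y.perm x.col]

lemma tot_one : tot (1 : GW m n) = 0 := by simp [tot]

lemma tot_inv (x : GW m n) : tot x⁻¹ = - tot x := by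
  have := tot_mul x x⁻¹
  rw [mul_inv_cancel, tot_one] at this
  linear_combination -this

lemma tot_trans {i j : Fin n} (hij : i ≠ j) (c : ZMod m) : tot (transRefl i j c) = 0 := by
  simp only [tot, transRefl]
  rw [Finset.sum_eq_add i j hij]
  · simp [hij.symm]
  · intro k _ hk
    simp [hk.1, hk.2]
  · simp
  · simp

lemma tot_diag (i : Fin n) (c : ZMod m) : tot (diagRefl i c) = c := by
  simp [tot, diagRefl]

/-- Elements with total color in `D`. -/
def totSub (D : AddSubgroup (ZMod m)) : Subgroup (GW m n) where
  carrier := {x | tot x ∈ D}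
  one_mem' := by simp [tot_one]
  mul_mem' := by
    intro a b ha hb
    show tot (a * b) ∈ D
    rw [tot_mul]; exact D.add_mem ha hb
  inv_mem' := by
    intro a ha
    show tot a⁻¹ ∈ D
    rw [tot_inv]; exact D.neg_mem ha

lemma trans_conj {x i j : Fin n} (h1 : x ≠ i) (h2 : x ≠ j) (h3 : i ≠ j) (c c' : ZMod m) :
    transRefl i j c * transRefl x i c' * transRefl i j c = transRefl x j (c' + c) := by
  have e1 : ∀ k, (transRefl i j c).perm k = Equiv.swap i j k := fun _ => rfl
  have e2 : ∀ k, (transRefl x i c').perm k = Equiv.swap x i k := fun _ => rfl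
  have e3 : ∀ k, (transRefl x j (c' + c)).perm k = Equiv.swap x j k := fun _ => rfl
  refine GW.ext ?_ ?_
  · refine Equiv.ext fun k => ?_
    simp only [mul_perm, Equiv.Perm.mul_apply, e1, e2, e3]
    simp only [Equiv.swap_apply_def]
    grind
  · funext k
    simp only [mul_col, transRefl]
    simp only [Equiv.swap_apply_def]
    grind

lemma conn_trans (X : Set (GW m n)) (hX : X ⊆ reflG1) (hC : Conn0 X) (i j : Fin n) (hij : i ≠ j) :
    ∃ c, transRefl i j c ∈ Subgroup.closure X := by
  set H := Subgroup.closure X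
  have := hC (fun y => y = i ∨ ∃ c, transRefl i y c ∈ H) ?_ i j (Or.inl rfl)
  · rcases this with h | h
    · exact absurd h.symm hij
    · exact h
  intro t ht x hx
  have key : ∀ a b c, a ≠ b → transRefl a b c ∈ H → (a = i ∨ ∃ c, transRefl i a c ∈ H) →
      (b = i ∨ ∃ c, transRefl i b c ∈ H) := by
    intro a b c hab hH ha
    by_cases hb : b = i
    · exact Or.inl hb
    · right
      rcases ha with rfl | ⟨c', hc'⟩
      · exact ⟨c, hH⟩
      · by_cases ha : a = i
        · subst ha; exact ⟨c, hH⟩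
        · refine ⟨c' + c, ?_⟩
          rw [← trans_conj (Ne.symm ha) (Ne.symm hb) hab c c']
          exact H.mul_mem (H.mul_mem hH hc') hH
  have htH : t ∈ H := Subgroup.subset_closure ht
  rcases hX ht with ⟨a, b, c, hab, rfl⟩ | ⟨a, c, -, rfl⟩
  · have e0 : (transRefl a b c).perm x = Equiv.swap a b x := rfl
    rw [e0]
    by_cases h1 : x = a
    · subst h1
      rw [Equiv.swap_apply_left]
      exact key x b c hab htH hx
    · by_cases h2 : x = b
      · subst h2
        rw [Equiv.swap_apply_right]
        refine key x a (-c) hab.symm ?_ hx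
        rw [← transRefl_symm _ _ _ hab]
        exact htH
      · rwa [Equiv.swap_apply_of_ne_of_ne h1 h2]
  · exact hx

lemma perm_surj (H : Subgroup (GW m n)) (h : ∀ i j : Fin n, i ≠ j → ∃ c, transRefl i j c ∈ H)
    (u : Equiv.Perm (Fin n)) : ∃ x ∈ H, x.perm = u := by
  induction u using Equiv.Perm.swap_induction_on with
  | one => exact ⟨1, H.one_mem, rfl⟩
  | swap_mul f x y hxy ih =>
    obtain ⟨a, ha, rfl⟩ := ih
    obtain ⟨c, hc⟩ := h x y hxy
    exact ⟨_, H.mul_mem hc ha, rfl⟩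

/-- The diagonal part. -/
def NN (H : Subgroup (GW m n)) : AddSubgroup (Fin n → ZMod m) where
  carrier := {a | (⟨1, a⟩ : GW m n) ∈ H}
  zero_mem' := H.one_mem
  add_mem' := by
    intro a b ha hb
    have := H.mul_mem ha hb
    have e : (⟨1, a⟩ : GW m n) * ⟨1, b⟩ = ⟨1, a + b⟩ := by ext k <;> simp
    rw [e] at this
    exact this
  neg_mem' := by
    intro a ha
    have := H.inv_mem ha
    have e : (⟨1, a⟩ : GW m n)⁻¹ = ⟨1, -a⟩ := by ext k <;> simp
    rw [e] at this
    exact this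

lemma mem_NN {H : Subgroup (GW m n)} {a : Fin n → ZMod m} :
    a ∈ NN H ↔ (⟨1, a⟩ : GW m n) ∈ H := Iff.rfl

lemma NN_conj {H : Subgroup (GW m n)} (h : ∀ i j : Fin n, i ≠ j → ∃ c, transRefl i j c ∈ H)
    {a : Fin n → ZMod m} (ha : a ∈ NN H) (u : Equiv.Perm (Fin n)) : a ∘ u ∈ NN H := by
  obtain ⟨x, hx, rfl⟩ := perm_surj H h u
  have := H.mul_mem (H.mul_mem (H.inv_mem hx) ha) hx
  have e : x⁻¹ * (⟨1, a⟩ : GW m n) * x = ⟨1, a ∘ x.perm⟩ := by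
    ext k
    · simp
    · simp
  rw [e] at this
  exact this

lemma mem_of_NN {H : Subgroup (GW m n)} (h : ∀ i j : Fin n, i ≠ j → ∃ c, transRefl i j c ∈ H)
    (hN : ∀ x ∈ H, ∀ y : GW m n, y.perm = x.perm → y.col - x.col ∈ NN H → y ∈ H := by
      intro x hx y hxy hy
      have := H.mul_mem hx hy
      have e : x * (⟨1, y.col - x.col⟩ : GW m n) = y := by
        ext k
        · simp [hxy]
        · simp
      rw [e] at this
      exact this) (y : GW m n) : ∃ x ∈ H, x.perm = y.perm ∧ (y.col - x.col ∈ NN H → y ∈ H) := by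
  obtain ⟨x, hx, hxy⟩ := perm_surj H h y.perm
  exact ⟨x, hx, hxy, hN x hx y hxy.symm⟩

lemma gen_G1 (hn : 1 ≤ n) (X : Set (GW m n)) (hX : X ⊆ reflG1) :
    Subgroup.closure X = ⊤ ↔ Conn0 X ∧ AddSubgroup.closure (tot '' X) = ⊤ := by
  constructor
  · intro h
    refine ⟨conn0_of X fun i j _ => by rw [h]; trivial, ?_⟩
    have hle : Subgroup.closure X ≤ totSub (AddSubgroup.closure (tot '' X)) :=
      (Subgroup.closure_le _).2 fun t ht => AddSubgroup.subset_closure ⟨t, ht, rfl⟩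
    rw [AddSubgroup.eq_top_iff']
    intro c
    have : diagRefl (⟨0, hn⟩ : Fin n) c ∈ Subgroup.closure X := by rw [h]; trivial
    have := hle this
    rw [← tot_diag (⟨0, hn⟩ : Fin n) c]
    exact this
  · rintro ⟨hC, hT⟩
    set H := Subgroup.closure X with hH
    have htr := conn_trans X hX hC
    let D : AddSubgroup (ZMod m) := (NN H).comap (AddMonoidHom.single (fun _ => ZMod m) (⟨0, hn⟩ : Fin n))
    have hD : ∀ i c, (Pi.single i c : Fin n → ZMod m) ∈ NN H ↔ c ∈ D := by
      intro i c
      have e1 : ∀ i j : Fin n, (Pi.single i c : Fin n → ZMod m) ∘ (Equiv.swap i j) = Pi.single j c := by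
        intro i j
        funext k
        simp only [Function.comp, Pi.single_apply, Equiv.swap_apply_def]
        grind
      constructor
      · intro h
        have := NN_conj htr h (Equiv.swap i ⟨0, hn⟩)
        rw [e1] at this
        exact this
      · intro h
        have := NN_conj htr (a := Pi.single (⟨0, hn⟩ : Fin n) c) h (Equiv.swap ⟨0, hn⟩ i)
        rw [e1] at this
        exact this
    have hDtop : D = ⊤ := by
      rw [eq_top_iff, ← hT, AddSubgroup.closure_le]
      rintro _ ⟨t, ht, rfl⟩
      rcases hX ht with ⟨i, j, c, hij, rfl⟩ | ⟨i, c, -, rfl⟩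
      · rw [tot_trans hij]; exact D.zero_mem
      · rw [tot_diag]
        refine (hD i c).1 ?_
        have e : diagRefl i c = (⟨1, Pi.single i c⟩ : GW m n) := by
          ext k
          · rfl
          · simp [diagRefl, Pi.single_apply]
        rw [mem_NN, ← e]
        exact Subgroup.subset_closure ht
    rw [Subgroup.eq_top_iff']
    intro y
    obtain ⟨x, hx, hxy, hy⟩ := mem_of_NN htr (y := y)
    apply hy
    rw [← Finset.univ_sum_single (y.col - x.col)]
    refine (NN H).sum_mem fun i _ => ?_
    rw [hD, hDtop]
    trivial

lemma mem_Gmm {x : GW m n} : x ∈ Gmm m n ↔ tot x = 0 := Iff.rfl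

lemma trans_mul_trans {i j : Fin n} (hij : i ≠ j) (c c' : ZMod m) :
    transRefl i j c * transRefl i j c' = ⟨1, Pi.single i (c' - c) - Pi.single j (c' - c)⟩ := by
  refine GW.ext ?_ ?_
  · refine Equiv.ext fun k => ?_
    simp [transRefl]
  · funext k
    simp only [mul_col, transRefl, Pi.sub_apply, Pi.single_apply, Equiv.swap_apply_def]
    grind

lemma gen_Gmm (hn : 2 ≤ n) (X : Set (GW m n)) (hX : X ⊆ reflGmm) :
    Subgroup.closure X = Gmm m n ↔
      Conn0 X ∧ ∀ D h, (∀ t ∈ X, t ∈ KK D h) → D = ⊤ := by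
  have hX1 : X ⊆ reflG1 := fun t ht => Or.inl (hX ht)
  have h01 : (⟨0, by omega⟩ : Fin n) ≠ ⟨1, by omega⟩ := by simp
  generalize (⟨0, by omega⟩ : Fin n) = x0 at h01
  generalize (⟨1, by omega⟩ : Fin n) = x1 at h01
  constructor
  · intro h
    refine ⟨conn0_of X fun i j hij => by rw [h]; exact tot_trans hij 0, ?_⟩
    intro D h' hD
    have hle : Gmm m n ≤ KK D h' := h ▸ (Subgroup.closure_le _).2 hD
    rw [AddSubgroup.eq_top_iff']
    intro c
    have := hle (mem_Gmm.2 (tot_trans h01 (c + (h' x1 - h' x0))))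
    rw [trans_mem_KK h01] at this
    simpa using this
  · rintro ⟨hC, hT⟩
    set H := Subgroup.closure X with hH
    have htr := conn_trans X hX1 hC
    have hle : H ≤ Gmm m n := (Subgroup.closure_le _).2 fun t ht => by
      obtain ⟨i, j, c, hij, rfl⟩ := hX ht
      exact tot_trans hij c
    let D : AddSubgroup (ZMod m) := (NN H).comap
      (AddMonoidHom.single (fun _ => ZMod m) x0 - AddMonoidHom.single (fun _ => ZMod m) x1)
    have hD : ∀ (i j : Fin n) (c : ZMod m), i ≠ j →
        ((Pi.single i c - Pi.single j c : Fin n → ZMod m) ∈ NN H ↔ c ∈ D) := by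
      intro i j c hij
      have hmem : c ∈ D ↔ (Pi.single x0 c - Pi.single x1 c : Fin n → ZMod m) ∈ NN H := Iff.rfl
      have e1 : ∀ (i j : Fin n) (u : Equiv.Perm (Fin n)),
          (Pi.single (u i) c - Pi.single (u j) c : Fin n → ZMod m) ∘ u
            = Pi.single i c - Pi.single j c := by
        intro i j u
        funext k
        simp [Function.comp, Pi.single_apply]
      obtain ⟨u, hu0, hu1⟩ : ∃ u : Equiv.Perm (Fin n), u x0 = i ∧ u x1 = j := by
        refine ⟨Equiv.swap (Equiv.swap x0 i x1) j * Equiv.swap x0 i, ?_, ?_⟩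
        · rw [Equiv.Perm.mul_apply, Equiv.swap_apply_left, Equiv.swap_apply_of_ne_of_ne _ hij]
          intro h
          apply h01
          apply (Equiv.swap x0 i).injective
          rw [← h, Equiv.swap_apply_left]
        · simp
      rw [hmem]
      subst hu0 hu1
      constructor
      · intro h
        have := NN_conj htr h u
        rwa [e1] at this
      · intro h
        have e2 := e1 (u x0) (u x1) u⁻¹
        have := NN_conj htr h u⁻¹
        have e3 : ∀ z, u⁻¹ (u z) = z := fun z => by simp
        rw [e3, e3] at e2
        rwa [e2] at this
    have hdiff : ∀ i j c c', i ≠ j → transRefl i j c ∈ H → transRefl i j c' ∈ H → c' - c ∈ D := by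
      intro i j c c' hij h1 h2
      have := H.mul_mem h1 h2
      rw [trans_mul_trans hij] at this
      exact (hD i j _ hij).1 this
    choose p hp using fun y (hy : x0 ≠ y) => htr x0 y hy
    let h : Fin n → ZMod m := fun y => if hy : x0 ≠ y then p y hy else 0
    have hh0 : h x0 = 0 := by simp [h]
    have hh : ∀ y, x0 ≠ y → transRefl x0 y (h y) ∈ H := by
      intro y hy
      simp only [h, dif_pos hy]
      exact hp y hy
    have hDtop : D = ⊤ := by
      apply hT D h
      intro t ht
      have htH : t ∈ H := Subgroup.subset_closure ht
      obtain ⟨i, j, c, hij, rfl⟩ := hX ht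
      rw [trans_mem_KK hij]
      by_cases hi : x0 = i
      · subst hi
        rw [hh0, sub_zero]
        exact hdiff _ _ _ _ hij (hh j hij) htH
      · by_cases hj : x0 = j
        · subst hj
          rw [transRefl_symm _ _ _ hij] at htH
          have := D.neg_mem (hdiff _ _ _ _ hij.symm (hh i hij.symm) htH)
          rw [hh0]
          convert this using 1
          ring
        · have h1 : transRefl x0 j (h i + c) ∈ H := by
            rw [← trans_conj hi hj hij]
            exact H.mul_mem (H.mul_mem htH (hh i hi)) htH
          have := hdiff _ _ _ _ hj (hh j hj) h1
          convert this using 1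
          ring
    refine le_antisymm hle fun y hy => ?_
    obtain ⟨x, hx, hxy, hy'⟩ := mem_of_NN htr (y := y)
    apply hy'
    have hs : ∑ i, (y.col - x.col) i = 0 := by
      have h1 : tot x = 0 := hle hx
      have h2 : tot y = 0 := hy
      simp only [tot] at h1 h2
      simp [Finset.sum_sub_distrib, h1, h2]
    generalize y.col - x.col = a at hs
    have e : a = ∑ i, (Pi.single i (a i) - Pi.single x0 (a i)) := by
      rw [Finset.sum_sub_distrib, Finset.univ_sum_single]
      have : ∑ i, (Pi.single x0 (a i) : Fin n → ZMod m) = Pi.single x0 (∑ i, a i) :=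
        (map_sum (AddMonoidHom.single (fun _ : Fin n => ZMod m) x0) a Finset.univ).symm
      rw [this, hs]
      simp
    rw [e]
    refine (NN H).sum_mem fun i _ => ?_
    by_cases hi : i = x0
    · subst hi; simp [(NN H).zero_mem]
    · rw [hD _ _ _ hi, hDtop]
      trivial

end RGSCount

open scoped Classical

namespace RGSCount

open GW

variable {m n k : ℕ} {ι : Type*}

/-- The block function of the cycles of `u` through the points `y i`. -/
noncomputable def bb (u : Equiv.Perm (Fin n)) (y : Fin k → Fin n) : Fin n → Option (Fin k) :=
  fun z => if h : ∃ i, u.SameCycle (y i) z then some h.choose else none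

lemma bb_some {u : Equiv.Perm (Fin n)} {y : Fin k → Fin n}
    (hy : ∀ i j, i ≠ j → ¬ u.SameCycle (y i) (y j)) {z : Fin n} {i : Fin k} :
    bb u y z = some i ↔ u.SameCycle (y i) z := by
  unfold bb
  constructor
  · intro h
    split_ifs at h with h1
    · rw [← Option.some.inj h]
      exact h1.choose_spec
  · intro h
    have h1 : ∃ i, u.SameCycle (y i) z := ⟨i, h⟩
    rw [dif_pos h1]
    by_contra hne
    refine hy h1.choose i (fun h' => hne (by rw [h'])) (h1.choose_spec.trans h.symm)

lemma bb_none {u : Equiv.Perm (Fin n)} {y : Fin k → Fin n} {z : Fin n} :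
    bb u y z = none ↔ ∀ i, ¬ u.SameCycle (y i) z := by
  unfold bb
  split_ifs with h
  · simpa using h
  · simpa using h

lemma bb_apply (u : Equiv.Perm (Fin n)) (y : Fin k → Fin n) (z : Fin n) :
    bb u y (u z) = bb u y z := by
  have : (fun i => u.SameCycle (y i) (u z)) = fun i => u.SameCycle (y i) z := by
    funext i
    exact propext Equiv.Perm.sameCycle_apply_right
  unfold bb
  simp only [Equiv.Perm.sameCycle_apply_right]

lemma bb_ne {u : Equiv.Perm (Fin n)} {y : Fin k → Fin n}
    (hz : ∀ z, ∃ i, u.SameCycle (y i) z) (z : Fin n) : bb u y z ≠ none := by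
  intro h
  obtain ⟨i, hi⟩ := hz z
  exact bb_none.1 h i hi

lemma bb_sameCycle {u : Equiv.Perm (Fin n)} {y : Fin k → Fin n}
    (hy : ∀ i j, i ≠ j → ¬ u.SameCycle (y i) (y j)) {x z : Fin n} (hx : bb u y x ≠ none)
    (h : bb u y x = bb u y z) : u.SameCycle x z := by
  obtain ⟨i, hi⟩ := Option.ne_none_iff_exists'.1 hx
  have h1 := (bb_some hy).1 hi
  rw [h] at hi
  exact h1.symm.trans ((bb_some hy).1 hi)

lemma lam_bb {u : Equiv.Perm (Fin n)} {y : Fin k → Fin n}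
    (hy : ∀ i j, i ≠ j → ¬ u.SameCycle (y i) (y j)) (i : Fin k) :
    lam (bb u y) (some i) = (orbit u (y i)).card := by
  unfold lam orbit
  simp only [bb_some hy]

lemma cycle_induct {u : Equiv.Perm (Fin n)} {f : Fin n → Prop} (hf : ∀ x, f x → f (u x))
    {x z : Fin n} (h : u.SameCycle x z) (hx : f x) : f z := by
  obtain ⟨s, rfl⟩ := sameCycle_pow h
  clear h
  induction s with
  | zero => simpa using hx
  | succ s ih =>
    rw [pow_succ', Equiv.Perm.mul_apply]
    exact hf _ ih

variable [NeZero m]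

lemma vv_fix {t : GW m n} {b : Fin n → ι} {h : Fin n → ZMod m} {a : ι} (hv : vv b h a ∈ VV t) :
    (∀ z, b (t.perm z) = a ↔ b z = a) ∧ ∀ z, b z = a → t.col z = h (t.perm z) - h z := by
  have h1 : ∀ z, b (t.perm z) = a ↔ b z = a := by
    intro z
    have := hv z
    simp only [vv] at this
    split_ifs at this with h1 h2 h2
    · exact ⟨fun _ => h2, fun _ => h1⟩
    · rw [mul_zero] at this
      exact absurd this (stdAddChar_ne_zero _)
    · exact absurd this.symm (mul_ne_zero (stdAddChar_ne_zero _) (stdAddChar_ne_zero _))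
    · exact ⟨fun h => absurd h h1, fun h => absurd h h2⟩
  refine ⟨h1, fun z hz => ?_⟩
  have := hv z
  simp only [vv, if_pos hz, if_pos ((h1 z).2 hz)] at this
  rw [← AddChar.map_add_eq_mul] at this
  rw [ZMod.injective_stdAddChar this]
  ring

/-- All the information on reduced factorizations that we need. -/
lemma setup (R : Set (GW m n)) (hR : R ⊆ reflG1) (g : GW m n) (y : Fin k → Fin n)
    (hy : ∀ i j, i ≠ j → ¬ g.perm.SameCycle (y i) (y j)) (h : Fin n → ZMod m)
    (hA : ∀ z, bb g.perm y z ≠ none → g.col z = h (g.perm z) - h z)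
    (hB : ∀ z, bb g.perm y z = none → cycColor g z ≠ 0)
    (l0 : List (GW m n)) (h0 : ∀ t ∈ l0, t ∈ R) (hp : l0.prod = g) (hlen : l0.length + k ≤ n) :
    n - Comb.rLen R g = k ∧ (Comb.Red R g).Nonempty ∧ ∀ l ∈ Comb.Red R g, ∀ t ∈ l,
      (∀ z, bb g.perm y (t.perm z) = bb g.perm y z) ∧
      ∀ z, bb g.perm y z ≠ none → t.col z = h (t.perm z) - h z := by
  have hfin : Module.finrank ℂ (VV g) ≤ k := by
    refine finrank_le_of y ?_
    intro v hv hvy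
    funext z
    by_cases hz : bb g.perm y z = none
    · exact VV_zero_of_color hv (hB z hz)
    · obtain ⟨i, hi⟩ := Option.ne_none_iff_exists'.1 hz
      exact VV_zero_of_sameCycle hv ((bb_some hy).1 hi) (hvy i)
  obtain ⟨h1, h2, h3⟩ := red_facts R hR g k hfin l0 h0 hp hlen
  refine ⟨by omega, ⟨l0, h2⟩, fun l hl t ht => ?_⟩
  have hv : ∀ i : Fin k, vv (bb g.perm y) h (some i) ∈ VV t := fun i => by
    refine h3 l hl t ht (vv_mem (bb_apply _ _) ?_)
    intro z hz
    exact hA z (by rw [hz]; simp)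
  constructor
  · intro z
    have key : ∀ i, bb g.perm y (t.perm z) = some i ↔ bb g.perm y z = some i :=
      fun i => (vv_fix (hv i)).1 z
    exact Option.ext fun i => key i
  · intro z hz
    obtain ⟨i, hi⟩ := Option.ne_none_iff_exists'.1 hz
    exact (vv_fix (hv i)).2 z hi

lemma conn_iff {b : Fin n → ι} {S : Set (GW m n)} {l : List (GW m n)}
    (h1 : ∀ t ∈ l, ∀ z, b (t.perm z) = b z)
    (h2 : ∀ f : Fin n → Prop, (∀ t ∈ l, ∀ x, f x → f (t.perm x)) →
      ∀ x z, b x = b z → f x → f z) :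
    Conn0 (S ∪ {x | x ∈ l}) ↔ Conn b S := by
  constructor
  · intro h f hf hS
    refine h f ?_
    rintro t (ht | ht) x hx
    · exact hS t ht x hx
    · exact hf x _ (h1 t ht x).symm hx
  · intro h f hf
    exact h f (h2 f fun t ht => hf t (Or.inr ht)) fun t ht => hf t (Or.inl ht)

lemma inv_prod {f : Fin n → Prop} (l : List (GW m n)) (hf : ∀ t ∈ l, ∀ x, f x → f (t.perm x)) :
    ∀ x, f x → f (l.prod.perm x) := by
  intro x hx
  have : l.prod ∈ stabF f := Subgroup.list_prod_mem _ fun t ht => mem_stabF (hf t ht)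
  exact (this x).1 hx

lemma rgs_char (R : Set (GW m n)) (H : Subgroup (GW m n)) (g : GW m n)
    (F : Finset (Finset (GW m n))) (hk : n - Comb.rLen R g = k) (hne : (Comb.Red R g).Nonempty)
    (hF : ∀ l ∈ Comb.Red R g, ∀ S : Finset (GW m n),
      (↑S ⊆ R ∧ S.card = k ∧ Subgroup.closure (↑S ∪ {x | x ∈ l}) = H) ↔ S ∈ F) :
    (Comb.RGS R H n g).ncard = F.card := by
  have : Comb.RGS R H n g = ↑F := by
    ext S
    simp only [Comb.RGS, Set.mem_ofPred_eq, Finset.mem_coe, hk]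
    constructor
    · rintro ⟨h1, h2, l, hl, h3⟩
      exact (hF l hl S).1 ⟨h1, h2, h3⟩
    · intro h
      obtain ⟨l, hl⟩ := hne
      obtain ⟨h1, h2, h3⟩ := (hF l hl S).2 h
      exact ⟨h1, h2, l, hl, h3⟩
  rw [this, Set.ncard_coe_finset]

/-- Sets of `q` transposition-like reflections connecting the blocks. -/
noncomputable def treeF (m : ℕ) [NeZero m] (b : Fin n → ι) (q : ℕ) : Finset (Finset (GW m n)) :=
  ((transFin m n).powersetCard q).filter fun S => Conn b (↑S : Set (GW m n))

/-- Sets of `q` transposition-like reflections connecting the blocks with full holonomy. -/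
noncomputable def uniF (b : Fin n → ι) (h : Fin n → ZMod m) (q : ℕ) : Finset (Finset (GW m n)) :=
  ((transFin m n).powersetCard q).filter fun S =>
    Conn b (↑S : Set (GW m n)) ∧ Hol b h (↑S : Set (GW m n))

lemma coe_toFinset (L : List (GW m n)) : (↑L.toFinset : Set (GW m n)) = {t | t ∈ L} := by
  ext; simp

lemma treeF_card (hn : 1 ≤ n) (b : Fin n → ι) (q : ℕ) (hb : (Finset.univ.image b).card = q + 1) :
    (n : ℚ) * (treeF m b q).card = (m : ℚ) ^ q * n ^ q * ∏ a ∈ Finset.univ.image b, lam b a := by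
  have h1 := cnt_set (transFin m n) q (treeF m b q) (by
    intro S hS
    have := Finset.mem_powersetCard.1 (Finset.mem_filter.1 hS).1
    exact this)
  have h2 := tree_count (m := m) q b hb
  have h3 : cnt (transFin m n) q (fun L => L.toFinset ∈ treeF m b q)
      = cnt (transFin m n) q (fun L => Conn b {t | t ∈ L}) := by
    refine cnt_congr _ _ _ _ ?_
    intro L hlen hL
    simp only [treeF, Finset.mem_filter, Finset.mem_powersetCard, coe_toFinset]
    constructor
    · exact fun h => h.2
    · intro h
      refine ⟨⟨fun t ht => hL t (List.mem_toFinset.1 ht), ?_⟩, h⟩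
      have := conn_card L.dedup (fun t ht => mem_transFin.1 (hL t (List.mem_dedup.1 ht))) b
        (by simpa using h)
      have h' := List.toFinset_card_le L
      rw [← List.card_toFinset] at this
      omega
  rw [← h3, h1] at h2
  have hq : ((q.factorial : ℕ) : ℚ) ≠ 0 := by exact_mod_cast q.factorial_ne_zero
  apply mul_left_cancel₀ hq
  linear_combination h2

lemma uniF_card (hm : 2 ≤ m) (hn : 1 ≤ n) (b : Fin n → ι) (h : Fin n → ZMod m) (q : ℕ)
    (hb : (Finset.univ.image b).card = q) :
    2 * ((uniF b h q).card : ℚ) = Nat.totient m * (m : ℚ) ^ (q - 1) *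
      Vf (Finset.univ.image b) (lam b) q n * ∏ a ∈ Finset.univ.image b, lam b a := by
  have h1 := cnt_set (transFin m n) q (uniF b h q) (by
    intro S hS
    have := Finset.mem_powersetCard.1 (Finset.mem_filter.1 hS).1
    exact this)
  have h2 := uni_count hn q b h hb
  have h3 : cnt (transFin m n) q (fun L => L.toFinset ∈ uniF b h q)
      = cnt (transFin m n) q (fun L => Conn b {t | t ∈ L} ∧ Hol b h {t | t ∈ L}) := by
    refine cnt_congr _ _ _ _ ?_
    intro L hlen hL
    simp only [uniF, Finset.mem_filter, Finset.mem_powersetCard, coe_toFinset]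
    constructor
    · exact fun h => h.2
    · intro hh
      refine ⟨⟨fun t ht => hL t (List.mem_toFinset.1 ht), ?_⟩, hh⟩
      have := cond_card hm L.dedup (fun t ht => mem_transFin.1 (hL t (List.mem_dedup.1 ht))) b h
        (by simpa using hh.1) (by simpa using hh.2)
      have h' := List.toFinset_card_le L
      rw [← List.card_toFinset] at this
      omega
  rw [← h3, h1] at h2
  have hq : ((q.factorial : ℕ) : ℚ) ≠ 0 := by exact_mod_cast q.factorial_ne_zero
  apply mul_left_cancel₀ hq
  linear_combination h2

end RGSCount

open scoped Classical

namespace RGSCount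

open GW

variable {m n k : ℕ} {ι : Type*}

lemma trans_sq {i j : Fin n} (hij : i ≠ j) (c : ZMod m) :
    (transRefl i j c : GW m n) * transRefl i j c = 1 := by
  rw [trans_mul_trans hij, sub_self]
  simp only [Pi.single_zero, sub_self]
  rfl

lemma diag_mul_diag (i : Fin n) (c d : ZMod m) :
    (diagRefl i c : GW m n) * diagRefl i d = diagRefl i (c + d) := by
  ext z
  · simp [diagRefl]
  · simp only [diagRefl, mul_col, Equiv.Perm.one_apply]
    by_cases h : z = i <;> simp [h]

lemma diag_zero (i : Fin n) : (diagRefl i 0 : GW m n) = 1 := by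
  ext z
  · simp [diagRefl]
  · simp [diagRefl]

lemma KK_bot_col {g : GW m n} {h : Fin n → ZMod m} (hg : g ∈ KK ⊥ h) (z : Fin n) :
    g.col z = h (g.perm z) - h z := by
  have := hg z
  rwa [AddSubgroup.mem_bot, sub_eq_zero] at this

lemma KK_bot_tot {g : GW m n} {h : Fin n → ZMod m} (hg : g ∈ KK ⊥ h) : tot g = 0 := by
  simp only [tot, KK_bot_col hg, Finset.sum_sub_distrib]
  rw [Equiv.sum_comp g.perm h, sub_self]

lemma lsub {R S : Set (GW m n)} (hS : S ⊆ R) {l : List (GW m n)} (hl : ∀ t ∈ l, t ∈ R) :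
    S ∪ {x | x ∈ l} ⊆ R := by
  rintro t (ht | ht)
  · exact hS ht
  · exact hl t ht

lemma conn_filter {b : Fin n → ι} {S : Finset (GW m n)} (hS : (↑S : Set (GW m n)) ⊆ reflG1)
    (hC : Conn b (↑S : Set (GW m n))) :
    Conn b (↑(S.filter fun t => t ∈ (reflGmm : Set (GW m n))) : Set (GW m n)) := by
  intro f hf hX
  refine hC f hf ?_
  intro t ht x hx
  rcases hS ht with h1 | ⟨i, c, -, rfl⟩
  · exact hX t (by simpa using ⟨ht, h1⟩) x hx
  · exact hx

lemma conn_card_fin {b : Fin n → ι} {S : Finset (GW m n)}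
    (hS : ∀ t ∈ S, t ∈ (reflGmm : Set (GW m n)))
    (hC : Conn b (↑S : Set (GW m n))) : (Finset.univ.image b).card ≤ S.card + 1 := by
  have := conn_card S.toList (fun t ht => hS t (Finset.mem_toList.1 ht)) b (by simpa using hC)
  simpa using this

variable [NeZero m]

lemma mem_treeF {b : Fin n → ι} {q : ℕ} {S : Finset (GW m n)} :
    S ∈ treeF m b q ↔ (∀ t ∈ S, t ∈ (reflGmm : Set (GW m n))) ∧ S.card = q ∧
      Conn b (↑S : Set (GW m n)) := by
  simp only [treeF, Finset.mem_filter, Finset.mem_powersetCard, and_assoc]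
  refine and_congr ?_ Iff.rfl
  exact ⟨fun h t ht => mem_transFin.1 (h ht), fun h t ht => mem_transFin.2 (h t ht)⟩

lemma image_bb_univ {inst : DecidableEq (Option (Fin k))} {u : Equiv.Perm (Fin n)} {y : Fin k → Fin n}
    (hy : ∀ i j, i ≠ j → ¬ u.SameCycle (y i) (y j)) {x : Fin n} (hx : bb u y x = none) :
    Finset.univ.image (bb u y) = Finset.univ := by
  rw [Finset.eq_univ_iff_forall]
  intro a
  rw [Finset.mem_image]
  cases a with
  | none => exact ⟨x, Finset.mem_univ _, hx⟩
  | some i => exact ⟨y i, Finset.mem_univ _, (bb_some hy).2 (Equiv.Perm.SameCycle.refl _ _)⟩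

lemma image_bb_some {inst : DecidableEq (Option (Fin k))} {u : Equiv.Perm (Fin n)} {y : Fin k → Fin n}
    (hy : ∀ i j, i ≠ j → ¬ u.SameCycle (y i) (y j)) (hz : ∀ z, ∃ i, u.SameCycle (y i) z) :
    Finset.univ.image (bb u y) = Finset.univ.map Function.Embedding.some := by
  ext a
  rw [Finset.mem_image, Finset.mem_map]
  cases a with
  | none =>
    constructor
    · rintro ⟨z, -, h⟩
      exact absurd h (bb_ne hz z)
    · rintro ⟨i, -, h⟩
      exact absurd h (by simp)
  | some i =>
    exact ⟨fun _ => ⟨i, Finset.mem_univ _, rfl⟩,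
      fun _ => ⟨y i, Finset.mem_univ _, (bb_some hy).2 (Equiv.Perm.SameCycle.refl _ _)⟩⟩

lemma case_one (hm : 2 ≤ m) (hn : 1 ≤ n) (g : GW m n) (x : Fin n) (y : Fin k → Fin n)
    (hxy : ∀ i, ¬ g.perm.SameCycle x (y i))
    (hy : ∀ i j, i ≠ j → ¬ g.perm.SameCycle (y i) (y j))
    (hz : ∀ z, g.perm.SameCycle x z ∨ ∃ i, g.perm.SameCycle (y i) z)
    (hgen : IsGen (cycColor g x)) (hcol : ∀ i, cycColor g (y i) = 0) :
    (Comb.RGS (reflG1 : Set (GW m n)) ⊤ n g).ncard = (treeF m (bb g.perm y) k).card := by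
  have hx : bb g.perm y x = none := bb_none.2 fun i h => hxy i h.symm
  have hx' : ∀ z, bb g.perm y z = none → g.perm.SameCycle x z := by
    intro z h
    rcases hz z with h1 | ⟨i, hi⟩
    · exact h1
    · exact absurd hi (bb_none.1 h i)
  set a := cycColor g x with ha
  have ha0 : a ≠ 0 := by
    have : Fact (1 < m) := ⟨by omega⟩
    exact ((isGen_iff a).1 hgen).ne_zero
  obtain ⟨h, hK⟩ := exists_pot (g * diagRefl x (-a)) (by
    intro z
    rw [diag_cycColor]
    by_cases h1 : g.perm.SameCycle z x
    · rw [if_pos h1, cycColor_congr g h1, ← ha, add_neg_cancel]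
    · rw [if_neg h1, add_zero]
      rcases hz z with h2 | ⟨i, hi⟩
      · exact absurd h2.symm h1
      · rw [← cycColor_congr g hi, hcol])
  have hperm : (g * diagRefl x (-a)).perm = g.perm := by simp [diagRefl]
  have hfr := finrank_ge (b := bb g.perm y) (by rw [hperm]; exact bb_apply _ _) hK
  rw [image_bb_univ hy hx, Finset.card_univ, Fintype.card_option, Fintype.card_fin] at hfr
  obtain ⟨l', hl', hlp, hll⟩ := upper h n _ hK (by omega)
  obtain ⟨hk, hne, hred⟩ := setup (reflG1 : Set (GW m n)) le_rfl g y hy h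
    (by
      intro z hzn
      have := KK_bot_col hK z
      rw [hperm] at this
      rw [← this]
      have hzx : z ≠ x := fun h => hzn (h ▸ hx)
      simp [diagRefl, hzx])
    (by
      intro z hzn
      rw [← cycColor_congr g (hx' z hzn)]
      exact ha0)
    (l' ++ [diagRefl x a])
    (by
      intro t ht
      rcases List.mem_append.1 ht with ht | ht
      · exact Or.inl (hl' t ht)
      · exact Or.inr ⟨x, a, ha0, by simpa using ht⟩)
    (by
      rw [List.prod_append, hlp, List.prod_singleton, mul_assoc, diag_mul_diag, neg_add_cancel,
        diag_zero, mul_one])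
    (by
      rw [List.length_append, List.length_singleton]
      omega)
  refine rgs_char _ _ _ _ hk hne ?_
  intro l hl S
  have hgl : l.prod = g := hl.2.1
  have hconn : Conn0 (↑S ∪ {x | x ∈ l}) ↔ Conn (bb g.perm y) (↑S : Set (GW m n)) := by
    refine conn_iff (fun t ht => (hred l hl t ht).1) ?_
    intro f hf u v huv hu
    have hfg := inv_prod l hf
    rw [hgl] at hfg
    refine cycle_induct hfg ?_ hu
    by_cases hun : bb g.perm y u = none
    · exact (hx' u hun).symm.trans (hx' v (huv ▸ hun))
    · exact bb_sameCycle hy hun huv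
  rw [mem_treeF]
  have htop : AddSubgroup.closure (tot '' (↑S ∪ {x | x ∈ l})) = ⊤ := by
    rw [eq_top_iff, ← hgen, AddSubgroup.closure_le, Set.singleton_subset_iff]
    have h1 : g ∈ totSub (AddSubgroup.closure (tot '' (↑S ∪ {x | x ∈ l}))) := by
      rw [← hgl]
      refine Subgroup.list_prod_mem _ fun t ht => ?_
      exact AddSubgroup.subset_closure ⟨t, Or.inr ht, rfl⟩
    have h2 : tot g = a := by
      have := KK_bot_tot hK
      rw [tot_mul, tot_diag] at this
      linear_combination this
    rw [← h2]
    exact h1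
  have hgenS : ∀ (hS : (↑S : Set (GW m n)) ⊆ reflG1),
      Subgroup.closure (↑S ∪ {x | x ∈ l}) = ⊤ ↔ Conn (bb g.perm y) (↑S : Set (GW m n)) := by
    intro hS
    rw [gen_G1 hn _ (lsub hS hl.1), hconn]
    exact ⟨fun h => h.1, fun h => ⟨h, htop⟩⟩
  constructor
  · rintro ⟨hS, hSk, hcl⟩
    rw [hgenS hS] at hcl
    have h1 := conn_filter hS hcl
    have h2 := conn_card_fin (by simp) h1
    rw [image_bb_univ hy hx, Finset.card_univ, Fintype.card_option, Fintype.card_fin] at h2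
    have h3 : (S.filter fun t => t ∈ (reflGmm : Set (GW m n))) = S :=
      Finset.eq_of_subset_of_card_le (Finset.filter_subset _ _) (by omega)
    refine ⟨?_, hSk, hcl⟩
    exact Finset.filter_eq_self.1 h3
  · rintro ⟨hS, hSk, hcl⟩
    have hS1 : (↑S : Set (GW m n)) ⊆ reflG1 := fun t ht => Or.inl (hS t ht)
    exact ⟨hS1, hSk, (hgenS hS1).2 hcl⟩

/-- Elements preserving `f` with vanishing color on `f`. -/
noncomputable def colF (f : Fin n → Prop) : Subgroup (GW m n) where
  carrier := {t | t ∈ stabF f ∧ ∑ z ∈ Finset.univ.filter f, t.col z = 0}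
  one_mem' := ⟨Subgroup.one_mem _, by simp⟩
  mul_mem' := by
    rintro a c ⟨ha, ha'⟩ ⟨hc, hc'⟩
    refine ⟨Subgroup.mul_mem _ ha hc, ?_⟩
    simp only [mul_col, Finset.sum_add_distrib]
    rw [hc', add_zero, ← ha']
    refine Finset.sum_equiv c.perm ?_ (fun _ _ => rfl)
    intro i
    simpa using hc i
  inv_mem' := by
    rintro a ⟨ha, ha'⟩
    refine ⟨Subgroup.inv_mem _ ha, ?_⟩
    simp only [inv_col, Finset.sum_neg_distrib]
    rw [neg_eq_zero, ← ha']
    refine Finset.sum_equiv a.perm⁻¹ ?_ (fun _ _ => rfl)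
    intro i
    have := Subgroup.inv_mem _ ha i
    simpa using this

lemma trans_mem_colF {f : Fin n → Prop} {i j : Fin n} (hij : i ≠ j) (c : ZMod m)
    (h : transRefl i j c ∈ (stabF f : Subgroup (GW m n))) :
    transRefl i j c ∈ (colF f : Subgroup (GW m n)) := by
  refine ⟨h, ?_⟩
  have h1 : f i ↔ f j := by
    have := h i
    simpa [transRefl] using this
  by_cases hi : f i
  · have hj := h1.1 hi
    have ht := tot_trans hij c
    rw [← ht, tot]
    refine Finset.sum_subset (Finset.subset_univ _) ?_
    intro z _ hz
    have hz' : ¬ f z := by simpa using hz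
    have hzi : z ≠ i := fun h => hz' (h ▸ hi)
    have hzj : z ≠ j := fun h => hz' (h ▸ hj)
    simp [transRefl, hzi, hzj]
  · have hj : ¬ f j := fun h => hi (h1.2 h)
    refine Finset.sum_eq_zero ?_
    intro z hz
    have hz' : f z := by simpa using hz
    have hzi : z ≠ i := fun h => hi (h ▸ hz')
    have hzj : z ≠ j := fun h => hj (h ▸ hz')
    simp [transRefl, hzi, hzj]

lemma two_cycles (g : GW m n) (x₁ x₂ : Fin n) (y : Fin k → Fin n)
    (hx2 : bb g.perm y x₂ = none)
    (hx1 : bb g.perm y x₁ = none)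
    (hz : ∀ z, bb g.perm y z = none → g.perm.SameCycle x₁ z ∨ g.perm.SameCycle x₂ z)
    (ha : cycColor g x₁ ≠ 0) (l : List (GW m n)) (hl : ∀ t ∈ l, t ∈ (reflGmm : Set (GW m n)))
    (hlp : l.prod = g) (hb : ∀ t ∈ l, ∀ z, bb g.perm y (t.perm z) = bb g.perm y z)
    (f : Fin n → Prop) (hf : ∀ t ∈ l, ∀ x, f x → f (t.perm x)) (h1 : f x₁) : f x₂ := by
  by_contra h2
  let f' : Fin n → Prop := fun z => f z ∧ bb g.perm y z = none
  have hfg : ∀ x, f x → f (g.perm x) := by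
    have := inv_prod l hf
    rwa [hlp] at this
  have h3 : ∀ t ∈ l, t ∈ (colF f' : Subgroup (GW m n)) := by
    intro t ht
    obtain ⟨i, j, c, hij, rfl⟩ := hl t ht
    apply trans_mem_colF hij
    apply mem_stabF
    rintro z ⟨hz1, hz2⟩
    exact ⟨hf _ ht z hz1, by rw [hb _ ht]; exact hz2⟩
  have h4 : g ∈ (colF f' : Subgroup (GW m n)) := hlp ▸ Subgroup.list_prod_mem _ h3
  apply ha
  rw [← h4.2]
  unfold cycColor orbit
  congr 1
  ext z
  simp only [Finset.mem_filter, Finset.mem_univ, true_and]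
  constructor
  · intro h
    refine ⟨cycle_induct hfg h h1, ?_⟩
    exact cycle_induct (f := fun z => bb g.perm y z = none)
      (fun z hz => by rw [bb_apply]; exact hz) h hx1
  · rintro ⟨h5, h6⟩
    rcases hz z h6 with h7 | h7
    · exact h7
    · exact absurd (cycle_induct hfg h7.symm h5) h2

lemma case_two (hm : 2 ≤ m) (g : GW m n) (x₁ x₂ : Fin n) (y : Fin k → Fin n)
    (hxx : ¬ g.perm.SameCycle x₁ x₂)
    (hxy1 : ∀ i, ¬ g.perm.SameCycle x₁ (y i))
    (hxy2 : ∀ i, ¬ g.perm.SameCycle x₂ (y i))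
    (hy : ∀ i j, i ≠ j → ¬ g.perm.SameCycle (y i) (y j))
    (hz : ∀ z, g.perm.SameCycle x₁ z ∨ g.perm.SameCycle x₂ z ∨ ∃ i, g.perm.SameCycle (y i) z)
    (hsum : cycColor g x₁ + cycColor g x₂ = 0)
    (hgen : AddSubgroup.closure ({cycColor g x₁, cycColor g x₂} : Set (ZMod m)) = ⊤)
    (hcol : ∀ i, cycColor g (y i) = 0) :
    (Comb.RGS (reflGmm : Set (GW m n)) (Gmm m n) n g).ncard
      = (treeF m (bb g.perm y) k).card := by
  have hx1 : bb g.perm y x₁ = none := bb_none.2 fun i h => hxy1 i h.symm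
  have hx2 : bb g.perm y x₂ = none := bb_none.2 fun i h => hxy2 i h.symm
  have hx' : ∀ z, bb g.perm y z = none → g.perm.SameCycle x₁ z ∨ g.perm.SameCycle x₂ z := by
    intro z h
    rcases hz z with h1 | h1 | ⟨i, hi⟩
    · exact Or.inl h1
    · exact Or.inr h1
    · exact absurd hi (bb_none.1 h i)
  have hx12 : x₁ ≠ x₂ := fun h => hxx (h ▸ Equiv.Perm.SameCycle.refl _ _)
  have hn : 2 ≤ n := by
    by_contra hcon
    apply hx12
    apply Fin.ext
    have := x₁.2
    have := x₂.2
    omega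
  set a := cycColor g x₁ with ha
  have ha2 : cycColor g x₂ = -a := by linear_combination hsum
  rw [ha2] at hgen
  have hDa : ∀ D : AddSubgroup (ZMod m), a ∈ D → D = ⊤ := by
    intro D hD
    rw [eq_top_iff, ← hgen, AddSubgroup.closure_le]
    rintro c (rfl | rfl)
    · exact hD
    · exact D.neg_mem hD
  have ha0 : a ≠ 0 := by
    intro h0
    have : Fact (1 < m) := ⟨by omega⟩
    exact bot_ne_top (hDa ⊥ (by rw [h0]; exact AddSubgroup.zero_mem _))
  obtain ⟨h, hK⟩ := exists_pot (g * diagRefl x₁ (-a) * diagRefl x₂ a) (by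
    intro z
    have hperm : (g * diagRefl x₁ (-a)).perm = g.perm := by simp [diagRefl]
    rw [diag_cycColor, diag_cycColor, hperm]
    by_cases h1 : g.perm.SameCycle z x₁
    · have h2 : ¬ g.perm.SameCycle z x₂ := fun h2 => hxx (h1.symm.trans h2)
      rw [if_pos h1, if_neg h2, cycColor_congr g h1, ← ha, add_neg_cancel, add_zero]
    · by_cases h2 : g.perm.SameCycle z x₂
      · rw [if_neg h1, if_pos h2, cycColor_congr g h2, ha2, add_zero, neg_add_cancel]
      · rw [if_neg h1, if_neg h2, add_zero, add_zero]
        rcases hz z with h3 | h3 | ⟨i, hi⟩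
        · exact absurd h3.symm h1
        · exact absurd h3.symm h2
        · rw [← cycColor_congr g hi, hcol])
  have hgcol : ∀ z, g.col z = h (g.perm z) - h z + (if z = x₁ then a else 0)
      - (if z = x₂ then a else 0) := by
    intro z
    have := KK_bot_col hK z
    simp only [mul_col, mul_perm, diagRefl, Equiv.Perm.one_apply, mul_one] at this
    split_ifs at this ⊢ with h1 h2 h2
    · exact absurd (h1.symm.trans h2) hx12
    · linear_combination this
    · linear_combination this
    · linear_combination this
  set c := a + h x₂ - h x₁ with hc
  set t0 : GW m n := transRefl x₁ x₂ c with ht0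
  have hK0 : g * t0 ∈ KK ⊥ h := by
    intro z
    rw [AddSubgroup.mem_bot, mul_col, mul_perm, Equiv.Perm.mul_apply]
    have e1 : t0.perm z = Equiv.swap x₁ x₂ z := rfl
    have e2 : t0.col z = if z = x₁ then c else if z = x₂ then -c else 0 := rfl
    rw [e1, e2]
    by_cases h1 : z = x₁
    · subst h1
      rw [Equiv.swap_apply_left, if_pos rfl, hgcol, if_neg hx12.symm, if_pos rfl, hc]
      ring
    · by_cases h2 : z = x₂
      · subst h2
        rw [Equiv.swap_apply_right, if_neg h1, if_pos rfl, hgcol, if_pos rfl, if_neg hx12, hc]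
        ring
      · rw [Equiv.swap_apply_of_ne_of_ne h1 h2, if_neg h1, if_neg h2, hgcol, if_neg h1, if_neg h2]
        ring
  have hfr := finrank_ge (b := bb g.perm y) (by
    intro z
    rw [mul_perm, Equiv.Perm.mul_apply, bb_apply]
    have e1 : t0.perm z = Equiv.swap x₁ x₂ z := rfl
    rw [e1]
    by_cases h1 : z = x₁
    · subst h1
      rw [Equiv.swap_apply_left, hx1, hx2]
    · by_cases h2 : z = x₂
      · subst h2
        rw [Equiv.swap_apply_right, hx1, hx2]
      · rw [Equiv.swap_apply_of_ne_of_ne h1 h2]) hK0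
  rw [image_bb_univ hy hx1, Finset.card_univ, Fintype.card_option, Fintype.card_fin] at hfr
  obtain ⟨l', hl', hlp, hll⟩ := upper h n _ hK0 (by omega)
  obtain ⟨hk, hne, hred⟩ := setup (reflGmm : Set (GW m n)) (fun t ht => Or.inl ht) g y hy h
    (by
      intro z hzn
      have hz1 : z ≠ x₁ := fun h => hzn (h ▸ hx1)
      have hz2 : z ≠ x₂ := fun h => hzn (h ▸ hx2)
      rw [hgcol, if_neg hz1, if_neg hz2]
      ring)
    (by
      intro z hzn
      rcases hx' z hzn with h1 | h1
      · rw [← cycColor_congr g h1]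
        exact ha0
      · rw [← cycColor_congr g h1, ha2]
        exact neg_ne_zero.2 ha0)
    (l' ++ [t0])
    (by
      intro t ht
      rcases List.mem_append.1 ht with ht | ht
      · exact hl' t ht
      · exact ⟨x₁, x₂, c, hx12, by simpa using ht⟩)
    (by
      rw [List.prod_append, hlp, List.prod_singleton, mul_assoc, ht0, trans_sq hx12, mul_one])
    (by
      rw [List.length_append, List.length_singleton]
      omega)
  refine rgs_char _ _ _ _ hk hne ?_
  intro l hl S
  have hgl : l.prod = g := hl.2.1
  have hconn : Conn0 (↑S ∪ {x | x ∈ l}) ↔ Conn (bb g.perm y) (↑S : Set (GW m n)) := by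
    refine conn_iff (fun t ht => (hred l hl t ht).1) ?_
    intro f hf u v huv hu
    have hfg := inv_prod l hf
    rw [hgl] at hfg
    by_cases hun : bb g.perm y u = none
    · have hvn := huv ▸ hun
      have t1 : f x₁ → f x₂ := two_cycles g x₁ x₂ y hx2 hx1 hx' ha0 l hl.1 hgl
        (fun t ht => (hred l hl t ht).1) f hf
      have t2 : f x₂ → f x₁ := two_cycles g x₂ x₁ y hx1 hx2 (fun z hz => (hx' z hz).symm)
        (by rw [ha2]; exact neg_ne_zero.2 ha0) l hl.1 hgl
        (fun t ht => (hred l hl t ht).1) f hf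
      have hf1 : f x₁ := by
        rcases hx' u hun with h1 | h1
        · exact cycle_induct hfg h1.symm hu
        · exact t2 (cycle_induct hfg h1.symm hu)
      rcases hx' v hvn with h1 | h1
      · exact cycle_induct hfg h1 hf1
      · exact cycle_induct hfg h1 (t1 hf1)
    · exact cycle_induct hfg (bb_sameCycle hy hun huv) hu
  rw [mem_treeF]
  have htop : ∀ D h', (∀ t ∈ (↑S ∪ {x | x ∈ l} : Set (GW m n)), t ∈ KK D h') → D = ⊤ := by
    intro D h' hD
    apply hDa
    have h1 : g ∈ KK D h' := hgl ▸ Subgroup.list_prod_mem _ fun t ht => hD t (Or.inr ht)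
    have h2 := Subgroup.pow_mem _ h1 (Function.minimalPeriod g.perm x₁) x₁
    have hfix : (g.perm ^ (Function.minimalPeriod g.perm x₁)) x₁ = x₁ := by
      rw [Equiv.Perm.coe_pow]; exact Function.iterate_minimalPeriod
    rw [period_col, pow_perm, hfix, sub_self, sub_zero] at h2
    exact h2
  constructor
  · rintro ⟨hS, hSk, hcl⟩
    rw [gen_Gmm hn _ (lsub hS hl.1), hconn] at hcl
    exact ⟨hS, hSk, hcl.1⟩
  · rintro ⟨hS, hSk, hcl⟩
    refine ⟨hS, hSk, ?_⟩
    rw [gen_Gmm hn _ (lsub hS hl.1), hconn]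
    exact ⟨hcl, htop⟩

lemma zero_setup (R : Set (GW m n)) (hR : R ⊆ reflG1) (hR2 : reflGmm ⊆ R) (g : GW m n)
    (y : Fin k → Fin n)
    (hy : ∀ i j, i ≠ j → ¬ g.perm.SameCycle (y i) (y j))
    (hz : ∀ z, ∃ i, g.perm.SameCycle (y i) z) (hcol : ∀ i, cycColor g (y i) = 0) :
    ∃ h, n - Comb.rLen R g = k ∧ (Comb.Red R g).Nonempty ∧ g ∈ KK ⊥ h ∧
      ∀ l ∈ Comb.Red R g, (∀ t ∈ l, t ∈ KK ⊥ h ∧ ∀ z, bb g.perm y (t.perm z) = bb g.perm y z) ∧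
        ∀ S : Set (GW m n), (Conn0 (S ∪ {x | x ∈ l}) ↔ Conn (bb g.perm y) S) := by
  obtain ⟨h, hK⟩ := exists_pot g (by
    intro z
    obtain ⟨i, hi⟩ := hz z
    rw [← cycColor_congr g hi, hcol])
  have hfr := finrank_ge (b := bb g.perm y) (bb_apply _ _) hK
  rw [image_bb_some hy hz, Finset.card_map, Finset.card_univ, Fintype.card_fin] at hfr
  obtain ⟨l', hl', hlp, hll⟩ := upper h n _ hK (by omega)
  obtain ⟨hk, hne, hred⟩ := setup R hR g y hy h (fun z _ => KK_bot_col hK z)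
    (fun z hzn => absurd hzn (bb_ne hz z)) l' (fun t ht => hR2 (hl' t ht)) hlp (by omega)
  refine ⟨h, hk, hne, hK, fun l hl => ⟨fun t ht => ⟨?_, (hred l hl t ht).1⟩, fun S => ?_⟩⟩
  · intro z
    rw [AddSubgroup.mem_bot, (hred l hl t ht).2 z (bb_ne hz z), sub_self]
  · refine conn_iff (fun t ht => (hred l hl t ht).1) ?_
    intro f hf u v huv hu
    have hfg := inv_prod l hf
    rw [hl.2.1] at hfg
    exact cycle_induct hfg (bb_sameCycle hy (bb_ne hz u) huv) hu

lemma phi_iff (g : GW m n) (y : Fin k → Fin n)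
    (hy : ∀ i j, i ≠ j → ¬ g.perm.SameCycle (y i) (y j))
    (hz : ∀ z, ∃ i, g.perm.SameCycle (y i) z) (h : Fin n → ZMod m) (hK : g ∈ KK ⊥ h)
    (l : List (GW m n)) (hlp : l.prod = g)
    (hl : ∀ t ∈ l, t ∈ KK ⊥ h ∧ ∀ z, bb g.perm y (t.perm z) = bb g.perm y z)
    (D : AddSubgroup (ZMod m)) (h' : Fin n → ZMod m) :
    (∀ t ∈ l, t ∈ KK D h') ↔ Phi (bb g.perm y) h D h' := by
  constructor
  · intro H
    have hg : g ∈ KK D h' := hlp ▸ Subgroup.list_prod_mem _ H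
    intro u v huv
    refine cycle_induct (u := g.perm) (f := fun v => h' u - h u - (h' v - h v) ∈ D) ?_
      (bb_sameCycle hy (bb_ne hz u) huv) (by simp)
    intro v hv
    have h1 := hg v
    rw [KK_bot_col hK] at h1
    convert D.add_mem hv h1 using 1
    ring
  · intro H t ht z
    rw [KK_bot_col (hl t ht).1]
    convert H z (t.perm z) ((hl t ht).2 z).symm using 1
    ring

lemma case_four (hn : 1 ≤ n) (g : GW m n) (y : Fin k → Fin n)
    (hy : ∀ i j, i ≠ j → ¬ g.perm.SameCycle (y i) (y j))
    (hz : ∀ z, ∃ i, g.perm.SameCycle (y i) z) (hcol : ∀ i, cycColor g (y i) = 0) :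
    ∃ h, (Comb.RGS (reflGmm : Set (GW m n)) (Gmm m n) n g).ncard
      = (uniF (m := m) (bb g.perm y) h k).card := by
  obtain ⟨h, hk, hne, hK, hred⟩ := zero_setup (reflGmm : Set (GW m n)) (fun t ht => Or.inl ht)
    le_rfl g y hy hz hcol
  refine ⟨h, rgs_char _ _ _ _ hk hne ?_⟩
  intro l hl S
  have hk0 : 0 < k := by
    obtain ⟨i, -⟩ := hz ⟨0, hn⟩
    exact i.pos
  have hmem : S ∈ uniF (m := m) (bb g.perm y) h k ↔ (∀ t ∈ S, t ∈ (reflGmm : Set (GW m n))) ∧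
      S.card = k ∧ Conn (bb g.perm y) (↑S : Set (GW m n)) ∧
        Hol (bb g.perm y) h (↑S : Set (GW m n)) := by
    simp only [uniF, Finset.mem_filter, Finset.mem_powersetCard, and_assoc]
    refine and_congr ?_ Iff.rfl
    exact ⟨fun h t ht => mem_transFin.1 (h ht), fun h t ht => mem_transFin.2 (h t ht)⟩
  rw [hmem]
  have hH : (∀ D h', (∀ t ∈ (↑S ∪ {x | x ∈ l} : Set (GW m n)), t ∈ KK D h') → D = ⊤) ↔
      Hol (bb g.perm y) h (↑S : Set (GW m n)) := by
    have hphi := phi_iff g y hy hz h hK l hl.2.1 (hred l hl).1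
    constructor
    · intro H D h' hP hS
      refine H D h' ?_
      rintro t (ht | ht)
      · exact hS t ht
      · exact (hphi D h').2 hP t ht
    · intro H D h' hD
      exact H D h' ((hphi D h').1 fun t ht => hD t (Or.inr ht)) fun t ht => hD t (Or.inl ht)
  have hgenS : (∀ t ∈ S, t ∈ (reflGmm : Set (GW m n))) → S.card = k →
      (Subgroup.closure (↑S ∪ {x | x ∈ l}) = Gmm m n ↔
        Conn (bb g.perm y) (↑S : Set (GW m n)) ∧ Hol (bb g.perm y) h (↑S : Set (GW m n))) := by
    intro hS hc
    obtain ⟨t, ht⟩ := Finset.card_pos.1 (hc ▸ hk0)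
    obtain ⟨i, j, c, hij, -⟩ := hS t ht
    have hn2 : 2 ≤ n := by
      by_contra hcon
      apply hij
      apply Fin.ext
      have := i.2
      have := j.2
      omega
    rw [gen_Gmm hn2 _ (lsub (fun t ht => hS t ht) hl.1), (hred l hl).2, hH]
  constructor
  · rintro ⟨hS, hc, hcl⟩
    exact ⟨hS, hc, (hgenS hS hc).1 hcl⟩
  · rintro ⟨hS, hc, hcl⟩
    exact ⟨hS, hc, (hgenS hS hc).2 hcl⟩

lemma trans_ne_diag {t : GW m n} (ht : t ∈ (reflGmm : Set (GW m n))) (i : Fin n) (c : ZMod m) :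
    t ≠ diagRefl i c := by
  rintro rfl
  obtain ⟨a, b, d, hab, h⟩ := ht
  have := congrArg (fun x : GW m n => x.perm a) h
  simp only [diagRefl, transRefl, Equiv.Perm.one_apply, Equiv.swap_apply_left] at this
  exact hab this

lemma case_three (hm : 2 ≤ m) (hn : 1 ≤ n) (g : GW m n) (y : Fin (k + 1) → Fin n)
    (hy : ∀ i j, i ≠ j → ¬ g.perm.SameCycle (y i) (y j))
    (hz : ∀ z, ∃ i, g.perm.SameCycle (y i) z) (hcol : ∀ i, cycColor g (y i) = 0) :
    (Comb.RGS (reflG1 : Set (GW m n)) ⊤ n g).ncard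
      = (treeF m (bb g.perm y) k).card * n * Nat.totient m := by
  obtain ⟨h, hk, hne, hK, hred⟩ := zero_setup (reflG1 : Set (GW m n)) le_rfl
    (fun t ht => Or.inl ht) g y hy hz hcol
  let F : Finset (Finset (GW m n)) :=
    ((treeF m (bb g.perm y) k) ×ˢ ((Finset.univ : Finset (Fin n)) ×ˢ
      (Finset.univ.filter fun c : ZMod m => IsGen c))).image
      fun p => insert (diagRefl p.2.1 p.2.2) p.1
  have hgen0 : ∀ c : ZMod m, IsGen c → c ≠ 0 := by
    intro c hc
    have : Fact (1 < m) := ⟨by omega⟩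
    exact ((isGen_iff c).1 hc).ne_zero
  have hFcard : F.card = (treeF m (bb g.perm y) k).card * n * Nat.totient m := by
    rw [Finset.card_image_of_injOn, Finset.card_product, Finset.card_product, card_gen,
      Finset.card_univ, Fintype.card_fin, mul_assoc]
    rintro ⟨T, i, c⟩ hp ⟨T', i', c'⟩ hp' heq
    simp only [Finset.coe_product, Set.mem_prod, Finset.mem_coe, Finset.mem_filter] at hp hp'
    have hT := (mem_treeF.1 hp.1).1
    have hT' := (mem_treeF.1 hp'.1).1
    simp only at heq
    have h1 : diagRefl i c = (diagRefl i' c' : GW m n) := by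
      have : diagRefl i c ∈ insert (diagRefl i' c') T' := heq ▸ Finset.mem_insert_self _ _
      rcases Finset.mem_insert.1 this with h | h
      · exact h
      · exact absurd rfl (trans_ne_diag (hT' _ h) i c)
    have h2 : T = T' := by
      rw [← Finset.erase_insert (a := diagRefl i c) (s := T)
        (fun h => trans_ne_diag (hT _ h) i c rfl), heq, h1,
        Finset.erase_insert (fun h => trans_ne_diag (hT' _ h) i' c' rfl)]
    have hc0 := hgen0 c hp.2.2.2
    have h3 : i = i' := by
      by_contra hii
      have := congrArg (fun x : GW m n => x.col i) h1
      simp only [diagRefl, if_neg hii, if_true] at this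
      exact hc0 this
    have h4 : c = c' := by
      have := congrArg (fun x : GW m n => x.col i) h1
      simpa [diagRefl, h3] using this
    rw [h2, h3, h4]
  rw [← hFcard]
  refine rgs_char _ _ _ _ hk hne ?_
  intro l hl S
  have hgenS : (↑S : Set (GW m n)) ⊆ reflG1 →
      (Subgroup.closure (↑S ∪ {x | x ∈ l}) = ⊤ ↔
        Conn (bb g.perm y) (↑S : Set (GW m n)) ∧
          AddSubgroup.closure (tot '' (↑S ∪ {x | x ∈ l})) = ⊤) := by
    intro hS
    rw [gen_G1 hn _ (lsub hS hl.1), (hred l hl).2]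
  have htl : ∀ t ∈ l, tot t = 0 := fun t ht => KK_bot_tot ((hred l hl).1 t ht).1
  have htT : ∀ t ∈ (reflGmm : Set (GW m n)), tot t = 0 := by
    rintro t ⟨i, j, c, hij, rfl⟩
    exact tot_trans hij c
  constructor
  · rintro ⟨hS, hSk, hcl⟩
    rw [hgenS hS] at hcl
    obtain ⟨hC, hT⟩ := hcl
    have h1 := conn_filter hS hC
    set T := S.filter fun t => t ∈ (reflGmm : Set (GW m n)) with hTdef
    have hTR : ∀ t ∈ T, t ∈ (reflGmm : Set (GW m n)) := fun t ht => (Finset.mem_filter.1 ht).2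
    have h2 := conn_card_fin hTR h1
    rw [image_bb_some hy hz, Finset.card_map, Finset.card_univ, Fintype.card_fin] at h2
    obtain ⟨d, hdS, hdT⟩ : ∃ d ∈ S, d ∉ T := by
      by_contra hcon
      push Not at hcon
      have hbot : AddSubgroup.closure (tot '' (↑S ∪ {x | x ∈ l})) ≤ (⊥ : AddSubgroup (ZMod m)) := by
        rw [AddSubgroup.closure_le]
        rintro _ ⟨t, ht | ht, rfl⟩
        · exact htT t (hTR t (hcon t ht))
        · exact htl t ht
      rw [hT] at hbot
      have : Fact (1 < m) := ⟨by omega⟩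
      exact bot_ne_top (le_antisymm bot_le hbot)
    have hsub : insert d T ⊆ S := Finset.insert_subset hdS (Finset.filter_subset _ _)
    have hci := Finset.card_insert_of_notMem hdT
    have hle := Finset.card_le_card hsub
    have heq : insert d T = S := Finset.eq_of_subset_of_card_le hsub (by omega)
    have hTc : T.card = k := by omega
    have hd : d ∉ (reflGmm : Set (GW m n)) := fun h => hdT (Finset.mem_filter.2 ⟨hdS, h⟩)
    rcases hS hdS with hd' | ⟨i, c, hc, rfl⟩
    · exact absurd hd' hd
    · refine Finset.mem_image.2 ⟨(T, i, c), ?_, heq⟩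
      refine Finset.mem_product.2 ⟨mem_treeF.2 ⟨hTR, hTc, h1⟩, Finset.mem_product.2
        ⟨Finset.mem_univ _, Finset.mem_filter.2 ⟨Finset.mem_univ _, ?_⟩⟩⟩
      unfold IsGen
      rw [eq_top_iff, ← hT, AddSubgroup.closure_le]
      rintro _ ⟨t, ht | ht, rfl⟩
      · rw [← heq, Finset.coe_insert] at ht
        rcases ht with rfl | ht
        · rw [tot_diag]
          exact AddSubgroup.subset_closure rfl
        · rw [htT t (hTR t ht)]
          exact AddSubgroup.zero_mem _
      · rw [htl t ht]
        exact AddSubgroup.zero_mem _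
  · intro hSF
    obtain ⟨⟨T, i, c⟩, hp, rfl⟩ := Finset.mem_image.1 hSF
    simp only [Finset.mem_product, Finset.mem_filter] at hp
    obtain ⟨hTR, hTk, hTC⟩ := mem_treeF.1 hp.1
    have hc := hp.2.2.2
    have hnot : diagRefl i c ∉ T := fun h => trans_ne_diag (hTR _ h) i c rfl
    have hS : (↑(insert (diagRefl i c) T) : Set (GW m n)) ⊆ reflG1 := by
      rw [Finset.coe_insert]
      rintro t (rfl | ht)
      · exact Or.inr ⟨i, c, hgen0 c hc, rfl⟩
      · exact Or.inl (hTR t ht)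
    refine ⟨hS, by rw [Finset.card_insert_of_notMem hnot, hTk], (hgenS hS).2 ⟨?_, ?_⟩⟩
    · intro f hf hX
      exact hTC f hf fun t ht => hX t (by simpa using Or.inr ht)
    · rw [eq_top_iff]
      have : AddSubgroup.closure ({c} : Set (ZMod m)) = ⊤ := hc
      rw [← this]
      apply AddSubgroup.closure_mono
      rw [Set.singleton_subset_iff]
      exact ⟨diagRefl i c, Or.inl (by simp), tot_diag i c⟩

end RGSCount

open scoped Classical

namespace RGSCount

open GW

variable {m n k : ℕ}

lemma final_tree [NeZero m] (hn : 1 ≤ n) (u : Equiv.Perm (Fin n)) (y : Fin k → Fin n)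
    (hy : ∀ i j, i ≠ j → ¬ u.SameCycle (y i) (y j)) (x : Fin n) (hx : bb u y x = none)
    (lam0 : ℕ) (l : Fin k → ℕ) (hl : ∀ i, (orbit u (y i)).card = l i)
    (h0 : (Finset.univ.filter fun z => bb u y z = none).card = lam0) :
    ((treeF m (bb u y) k).card : ℚ) = (m : ℚ) ^ (k : ℤ) * (n : ℚ) ^ ((k : ℤ) - 1) * (lam0 : ℚ) *
            ∏ i, (l i : ℚ) := by
  have h := treeF_card (m := m) hn (bb u y) k (by
    rw [image_bb_univ hy hx, Finset.card_univ, Fintype.card_option, Fintype.card_fin])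
  rw [image_bb_univ hy hx, Fintype.prod_option] at h
  have hn0 : (n : ℚ) ≠ 0 := by
    have : n ≠ 0 := by omega
    exact_mod_cast this
  have e0 : lam (bb u y) none = lam0 := by
    rw [← h0]; unfold lam; congr!
  have e1 : ∀ i, lam (bb u y) (some i) = l i := fun i => by rw [lam_bb hy, hl]
  simp only [e0, e1] at h
  rw [zpow_sub₀ hn0, zpow_natCast, zpow_natCast, zpow_one]
  field_simp
  linarith

lemma final_map_prod (u : Equiv.Perm (Fin n)) (y : Fin k → Fin n)
    (hy : ∀ i j, i ≠ j → ¬ u.SameCycle (y i) (y j))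
    (l : Fin k → ℕ) (hl : ∀ i, (orbit u (y i)).card = l i) (T : Finset (Fin k)) :
    ∏ a ∈ T.map Function.Embedding.some, lam (bb u y) a = ∏ i ∈ T, (l i : ℚ) := by
  rw [Finset.prod_map]
  refine Finset.prod_congr rfl fun i _ => ?_
  rw [← hl i, ← lam_bb hy i]
  rfl

lemma final_es (u : Equiv.Perm (Fin n)) (y : Fin k → Fin n)
    (hy : ∀ i j, i ≠ j → ¬ u.SameCycle (y i) (y j))
    (l : Fin k → ℕ) (hl : ∀ i, (orbit u (y i)).card = l i) (j : ℕ) :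
    es ((Finset.univ : Finset (Fin k)).map Function.Embedding.some) (lam (bb u y)) j
      = ∑ T ∈ (Finset.univ : Finset (Fin k)).powersetCard j, ∏ i ∈ T, (l i : ℚ) := by
  unfold es
  rw [Finset.powersetCard_map, Finset.sum_map]
  refine Finset.sum_congr rfl fun T _ => ?_
  exact final_map_prod u y hy l hl T

end RGSCount
open Comb GW in
/-- enumeration of relative generating sets of parabolic quasi-Coxeter
elements in `G(m,1,n)` and `G(m,m,n)` (cycles are described by a system of
representatives of the orbits of the underlying permutation, fixed points included):
(i) one cycle of generating color (resp. two cycles of colors generating `ℤ/mℤ` and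
summing to `0`, of lengths summing to `λ₀`) and `k` cycles of color `0`;
(ii), (iii) all cycles of color `0`. -/
theorem card_RGS_infinite_families
    (m n : ℕ) (hm : 2 ≤ m) (hn : 1 ≤ n) :
    -- (i) for `W = G(m,1,n)`
    (∀ (k : ℕ) (g : GW m n) (lam0 : ℕ) (lam : Fin k → ℕ)
        (x : Fin n) (y : Fin k → Fin n),
      (∀ i, ¬ g.perm.SameCycle x (y i)) →
      (∀ i j, i ≠ j → ¬ g.perm.SameCycle (y i) (y j)) →
      (∀ z, g.perm.SameCycle x z ∨ ∃ i, g.perm.SameCycle (y i) z) →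
      (orbit g.perm x).card = lam0 →
      (∀ i, (orbit g.perm (y i)).card = lam i) →
      AddSubgroup.closure ({cycColor g x} : Set (ZMod m)) = ⊤ →
      (∀ i, cycColor g (y i) = 0) →
      (((RGS (reflG1 : Set (GW m n)) ⊤ n g).ncard : ℚ)
        = (m : ℚ) ^ (k : ℤ) * (n : ℚ) ^ ((k : ℤ) - 1) * (lam0 : ℚ) *
            ∏ i, (lam i : ℚ))) ∧
    -- (i) for `W = G(m,m,n)`
    (∀ (k : ℕ) (g : GW m n) (lam0 : ℕ) (lam : Fin k → ℕ)
        (x₁ x₂ : Fin n) (y : Fin k → Fin n),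
      ¬ g.perm.SameCycle x₁ x₂ →
      (∀ i, ¬ g.perm.SameCycle x₁ (y i)) →
      (∀ i, ¬ g.perm.SameCycle x₂ (y i)) →
      (∀ i j, i ≠ j → ¬ g.perm.SameCycle (y i) (y j)) →
      (∀ z, g.perm.SameCycle x₁ z ∨ g.perm.SameCycle x₂ z ∨
        ∃ i, g.perm.SameCycle (y i) z) →
      (orbit g.perm x₁).card + (orbit g.perm x₂).card = lam0 →
      (∀ i, (orbit g.perm (y i)).card = lam i) →
      cycColor g x₁ + cycColor g x₂ = 0 →
      AddSubgroup.closure ({cycColor g x₁, cycColor g x₂} : Set (ZMod m)) = ⊤ →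
      (∀ i, cycColor g (y i) = 0) →
      (((RGS (reflGmm : Set (GW m n)) (Gmm m n) n g).ncard : ℚ)
        = (m : ℚ) ^ (k : ℤ) * (n : ℚ) ^ ((k : ℤ) - 1) * (lam0 : ℚ) *
            ∏ i, (lam i : ℚ))) ∧
    -- (ii) for `W = G(m,1,n)`, all cycles of color `0`
    (∀ (k : ℕ) (g : GW m n) (lam : Fin k → ℕ) (y : Fin k → Fin n),
      (∀ i j, i ≠ j → ¬ g.perm.SameCycle (y i) (y j)) →
      (∀ z, ∃ i, g.perm.SameCycle (y i) z) →
      (∀ i, (orbit g.perm (y i)).card = lam i) →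
      (∀ i, cycColor g (y i) = 0) →
      (((RGS (reflG1 : Set (GW m n)) ⊤ n g).ncard : ℚ)
        = (Nat.totient m : ℚ) * (m : ℚ) ^ ((k : ℤ) - 1) *
            (n : ℚ) ^ ((k : ℤ) - 1) * ∏ i, (lam i : ℚ))) ∧
    -- (iii) for `W = G(m,m,n)`, all cycles of color `0`
    (∀ (k : ℕ) (g : GW m n) (lam : Fin k → ℕ) (y : Fin k → Fin n),
      (∀ i j, i ≠ j → ¬ g.perm.SameCycle (y i) (y j)) →
      (∀ z, ∃ i, g.perm.SameCycle (y i) z) →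
      (∀ i, (orbit g.perm (y i)).card = lam i) →
      (∀ i, cycColor g (y i) = 0) →
      (((RGS (reflGmm : Set (GW m n)) (Gmm m n) n g).ncard : ℚ)
        = (Nat.totient m : ℚ) * (m : ℚ) ^ ((k : ℤ) - 1) / 2 *
            ((n : ℚ) ^ (k : ℤ) - (n : ℚ) ^ ((k : ℤ) - 1) -
              ∑ j ∈ Finset.Icc 2 k, (Nat.factorial (j - 2) : ℚ) *
                (n : ℚ) ^ ((k : ℤ) - (j : ℤ)) *
                ∑ T ∈ (Finset.univ : Finset (Fin k)).powersetCard j,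
                  ∏ i ∈ T, (lam i : ℚ)) *
            ∏ i, (lam i : ℚ))) := by

  haveI : NeZero m := ⟨by omega⟩
  have hn0 : (n : ℚ) ≠ 0 := by
    have : n ≠ 0 := by omega
    exact_mod_cast this
  refine ⟨?_, ?_, ?_, ?_⟩
  · intro k g lam0 lam x y hxy hy hz h0 hl hgen hcol
    rw [RGSCount.case_one hm hn g x y hxy hy hz hgen hcol]
    refine RGSCount.final_tree hn g.perm y hy x
      (RGSCount.bb_none.2 fun i h => hxy i h.symm) lam0 lam hl ?_
    rw [← h0]
    congr 1
    unfold orbit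
    ext z
    rw [Finset.mem_filter, Finset.mem_filter, RGSCount.bb_none]
    refine and_congr_right fun _ => ⟨fun h => ?_, fun h i hi => hxy i (h.trans hi.symm)⟩
    rcases hz z with h1 | ⟨i, hi⟩
    · exact h1
    · exact absurd hi (h i)
  · intro k g lam0 lam x₁ x₂ y hxx hxy1 hxy2 hy hz h0 hl hsum hgen hcol
    rw [RGSCount.case_two hm g x₁ x₂ y hxx hxy1 hxy2 hy hz hsum hgen hcol]
    refine RGSCount.final_tree hn g.perm y hy x₁
      (RGSCount.bb_none.2 fun i h => hxy1 i h.symm) lam0 lam hl ?_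
    rw [← h0, ← Finset.card_union_of_disjoint]
    · congr 1
      unfold orbit
      ext z
      rw [Finset.mem_filter, Finset.mem_union, Finset.mem_filter, Finset.mem_filter,
        RGSCount.bb_none]
      constructor
      · rintro ⟨hu, h⟩
        rcases hz z with h1 | h1 | ⟨i, hi⟩
        · exact Or.inl ⟨hu, h1⟩
        · exact Or.inr ⟨hu, h1⟩
        · exact absurd hi (h i)
      · rintro (⟨hu, h⟩ | ⟨hu, h⟩)
        · exact ⟨hu, fun i hi => hxy1 i (h.trans hi.symm)⟩
        · exact ⟨hu, fun i hi => hxy2 i (h.trans hi.symm)⟩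
    · rw [Finset.disjoint_left]
      intro z h1 h2
      exact hxx ((Finset.mem_filter.1 h1).2.trans (Finset.mem_filter.1 h2).2.symm)
  · intro k g lam y hy hz hl hcol
    obtain ⟨i0, -⟩ := hz ⟨0, hn⟩
    obtain ⟨q, rfl⟩ : ∃ q, k = q + 1 := ⟨k - 1, by have := i0.2; omega⟩
    rw [RGSCount.case_three hm hn g y hy hz hcol]
    have h := RGSCount.treeF_card (m := m) hn (RGSCount.bb g.perm y) q (by
      rw [RGSCount.image_bb_some hy hz, Finset.card_map, Finset.card_univ, Fintype.card_fin])
    rw [RGSCount.image_bb_some hy hz, RGSCount.final_map_prod g.perm y hy lam hl] at h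
    have e : ((q + 1 : ℕ) : ℤ) - 1 = (q : ℤ) := by push_cast; ring
    rw [e, zpow_natCast, zpow_natCast]
    push_cast
    linear_combination (m.totient : ℚ) * h
  · intro k g lam y hy hz hl hcol
    obtain ⟨i0, -⟩ := hz ⟨0, hn⟩
    obtain ⟨q, rfl⟩ : ∃ q, k = q + 1 := ⟨k - 1, by have := i0.2; omega⟩
    obtain ⟨hh, hc⟩ := RGSCount.case_four hn g y hy hz hcol
    rw [hc]
    have h := RGSCount.uniF_card (m := m) hm hn (RGSCount.bb g.perm y) hh (q + 1) (by
      rw [RGSCount.image_bb_some hy hz, Finset.card_map, Finset.card_univ, Fintype.card_fin])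
    rw [RGSCount.image_bb_some hy hz, RGSCount.final_map_prod g.perm y hy lam hl] at h
    unfold RGSCount.Vf at h
    have e : ((q + 1 : ℕ) : ℤ) - 1 = (q : ℤ) := by push_cast; ring
    have hs : ∑ j ∈ Finset.Icc 2 (q + 1), (Nat.factorial (j - 2) : ℚ) *
                (n : ℚ) ^ (((q + 1 : ℕ) : ℤ) - (j : ℤ)) *
                ∑ T ∈ (Finset.univ : Finset (Fin (q + 1))).powersetCard j,
                  ∏ i ∈ T, (lam i : ℚ)
        = ∑ j ∈ Finset.range (q + 1 - 1), (j.factorial : ℚ) * (n : ℚ) ^ (q + 1 - 2 - j)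
          * RGSCount.es ((Finset.univ : Finset (Fin (q + 1))).map Function.Embedding.some)
            (RGSCount.lam (RGSCount.bb g.perm y)) (j + 2) := by
      symm
      refine Finset.sum_bij (fun j _ => j + 2) ?_ ?_ ?_ ?_
      · intro j hj
        rw [Finset.mem_range] at hj
        exact Finset.mem_Icc.2 ⟨by omega, by omega⟩
      · intro a _ b _ hab
        omega
      · intro j hj
        rw [Finset.mem_Icc] at hj
        exact ⟨j - 2, Finset.mem_range.2 (by omega), by omega⟩
      · intro j hj
        rw [Finset.mem_range] at hj
        have e2 : ((q + 1 : ℕ) : ℤ) - ((j + 2 : ℕ) : ℤ) = ((q + 1 - 2 - j : ℕ) : ℤ) := by omega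
        rw [RGSCount.final_es g.perm y hy lam hl, e2, zpow_natCast]
        rfl
    rw [hs, e, zpow_natCast, zpow_natCast, zpow_natCast]
    simp only [Nat.add_sub_cancel] at h ⊢
    linear_combination h / 2
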